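/- arXiv:0710.0027 — 7 statements merged into one kernel-verified Lean document; each statement's English description precedes it below -/
import Mathlib

section
/- For all positive integers Δ, k, and q, there exists a constant c(Δ,k,q) such that, if H_1,...,H_q are k-uniform hypergraphs each with n vertices and maximum degree at most Δ, then the q-colour Ramsey number satisfies r(H_1,...,H_q) ≤ c(Δ,k,q)·n. -/
open Finset

theorem Finset.exists_mono_of_card_le {q : ℕ} (k : ℕ) (s : Fin q → ℕ) :
    ∃ M : ℕ, ∀ (β : Type) [DecidableEq β] (A : Finset β), M ≤ #A → ∀ χ : Finset β → Fin q,
      ∃ i, ∃ B ⊆ A, #B = s i ∧ ∀ S ⊆ B, #S = k → χ S = i := by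
  induction k generalizing s with
  | zero =>
    refine ⟨∑ i, s i, fun β _ A hA χ => ?_⟩
    obtain ⟨B, hBA, hB⟩ := exists_subset_card_eq
      ((single_le_sum (fun i _ => Nat.zero_le (s i)) (mem_univ (χ ∅))).trans hA)
    refine ⟨χ ∅, B, hBA, hB, fun S _ hS => ?_⟩
    rw [card_eq_zero.1 hS]
  | succ k ih =>
    induction hn : ∑ i, s i generalizing s with
    | zero =>
      refine ⟨0, fun β _ A _ χ => ⟨χ ∅, ∅, empty_subset _, ?_, fun S hS hc => ?_⟩⟩
      · simpa using (sum_eq_zero_iff.1 hn (χ ∅) (mem_univ _)).symm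
      · simp [subset_empty.1 hS] at hc
    | succ n ihn =>
      by_cases h0 : ∃ i, s i = 0
      · obtain ⟨i, hi⟩ := h0
        refine ⟨0, fun β _ A _ χ => ⟨i, ∅, empty_subset _, by simp [hi], fun S hS hc => ?_⟩⟩
        simp [subset_empty.1 hS] at hc
      · push Not at h0
        have key (i : Fin q) := ihn (Function.update s i (s i - 1)) (by
          have := add_sum_erase univ s (mem_univ i)
          have h1 := add_sum_erase univ (Function.update s i (s i - 1)) (mem_univ i)
          have h2 : ∑ j ∈ univ.erase i, Function.update s i (s i - 1) j = ∑ j ∈ univ.erase i, s j :=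
            sum_congr rfl fun j hj => by simp [(mem_erase.1 hj).1]
          simp only [Function.update_self] at h1
          have := h0 i
          omega)
        choose M hM using key
        obtain ⟨R, hR⟩ := ih (fun _ => ∑ i, M i)
        refine ⟨R + 1, fun β _ A hA χ => ?_⟩
        obtain ⟨v, hv⟩ : A.Nonempty := card_pos.1 (by omega)
        obtain ⟨i, A', hA'A, hA', hi⟩ := hR β (A.erase v) (by rw [card_erase_of_mem hv]; omega)
          (fun S => χ (insert v S))
        obtain ⟨j, B, hBA', hB, hj⟩ := hM i β A'
          (hA' ▸ single_le_sum (fun i _ => Nat.zero_le (M i)) (mem_univ i)) χ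
        have hvB : v ∉ B := fun h => by simpa using hA'A (hBA' h)
        have hBA : B ⊆ A := fun b hb => erase_subset _ _ (hA'A (hBA' hb))
        by_cases hij : j = i
        · subst hij
          have := h0 j
          refine ⟨j, insert v B, insert_subset hv hBA, ?_, fun S hS hc => ?_⟩
          · rw [card_insert_of_notMem hvB, hB, Function.update_self]; omega
          · by_cases hvS : v ∈ S
            · rw [← hi (S.erase v) ((subset_insert_iff.1 hS).trans hBA')
                (by rw [card_erase_of_mem hvS]; omega), insert_erase hvS]
            · exact hj S ((subset_insert_iff_of_notMem hvS).1 hS) hc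
        · exact ⟨j, B, hBA, by rw [hB, Function.update_of_ne hij], hj⟩

/-- Ramsey's theorem for `k`-uniform hypergraphs and finitely many colours. -/
theorem exists_ramsey (k q r : ℕ) :
    ∃ M : ℕ, ∀ χ : Finset (Fin M) → Fin q,
      ∃ i, ∃ g : Fin r ↪ Fin M, ∀ S : Finset (Fin r), #S = k → χ (S.map g) = i := by
  obtain ⟨M, hM⟩ := Finset.exists_mono_of_card_le (q := q) k (fun _ => r)
  refine ⟨M, fun χ => ?_⟩
  obtain ⟨i, B, -, hBr, hi⟩ := hM (Fin M) univ (by simp) χ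
  refine ⟨i, (B.orderEmbOfFin hBr).toEmbedding, fun S hS => hi _ (fun b hb => ?_) (by simpa)⟩
  obtain ⟨a, -, rfl⟩ := mem_map.1 hb
  exact B.orderEmbOfFin_mem hBr a

theorem exists_coloring_of_card_le {V : Type*} [Fintype V] [DecidableEq V] (D : ℕ)
    (R : V → V → Prop) [DecidableRel R] (hR : ∀ u v, R u v → R v u)
    (hD : ∀ u, #{v | R u v} ≤ D) :
    ∃ col : V → Fin (D + 1), ∀ u v, u ≠ v → R u v → col u ≠ col v := by
  suffices h : ∀ P : Finset V, ∃ col : V → Fin (D + 1),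
      ∀ u ∈ P, ∀ v ∈ P, u ≠ v → R u v → col u ≠ col v by
    obtain ⟨col, hcol⟩ := h univ
    exact ⟨col, fun u v => hcol u (mem_univ _) v (mem_univ _)⟩
  intro P
  induction P using Finset.induction_on with
  | empty => exact ⟨fun _ => 0, by simp⟩
  | insert w P hw ih =>
    obtain ⟨col, hcol⟩ := ih
    obtain ⟨c, -, hc⟩ := exists_mem_notMem_of_card_lt_card
      (s := image col {v | R w v}) (t := univ)
      ((card_image_le.trans (hD w)).trans_lt (by simp))
    simp only [mem_image, mem_filter, mem_univ, true_and, not_exists, not_and] at hc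
    refine ⟨Function.update col w c, fun u hu v hv huv h => ?_⟩
    by_cases h1 : u = w
    · subst h1
      simpa [huv.symm] using Ne.symm (hc v h)
    · by_cases h2 : v = w
      · subst h2
        simpa [h1] using hc u (hR _ _ h)
      · simpa [h1, h2] using
          hcol u ((mem_insert.1 hu).resolve_left h1) v ((mem_insert.1 hv).resolve_left h2) huv h

open scoped Classical in
theorem sum_card_update {V α : Type*} [Fintype V] [Fintype α] [DecidableEq V]
    (u : V) (X : (V → α) → Prop) :
    ∑ z, #{g : V → α | X (Function.update g u z)} = Fintype.card α * #{g : V → α | X g} := by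
  simp only [card_filter]
  rw [← card_univ (α := α), ← smul_eq_mul, ← sum_const, ← sum_product', ← sum_product']
  refine sum_nbij' (fun p => (p.2 u, Function.update p.2 u p.1))
    (fun p => (p.2 u, Function.update p.2 u p.1)) ?_ ?_ ?_ ?_ ?_ <;> simp

open scoped Classical in
theorem card_comp_mul {S V α : Type*} [Fintype S] [Fintype V] [Fintype α]
    [DecidableEq S] [DecidableEq V]
    (ψ : S ↪ V) (X : (S → α) → Prop) :
    #{g : V → α | X (g ∘ ψ)} * Fintype.card α ^ Fintype.card S =
      #{h : S → α | X h} * Fintype.card α ^ Fintype.card V := by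
  rw [← Fintype.card_fun, ← Fintype.card_fun, ← card_univ, ← card_univ, ← card_product,
    ← card_product]
  have hext (h : S → α) (g : V → α) : Function.extend ψ (g ∘ ψ) (Function.extend ψ h g) = g := by
    ext v
    by_cases hv : ∃ s, ψ s = v
    · obtain ⟨s, rfl⟩ := hv
      rw [ψ.injective.extend_apply]; rfl
    · rw [Function.extend_apply' _ _ _ hv, Function.extend_apply' _ _ _ hv]
  have hcomp (h : S → α) (g : V → α) : Function.extend ψ h g ∘ ψ = h :=
    Function.extend_comp ψ.injective h g
  refine card_nbij' (fun p => (p.1 ∘ ψ, Function.extend ψ p.2 p.1))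
    (fun p => (Function.extend ψ p.1 p.2, p.2 ∘ ψ)) ?_ ?_ ?_ ?_
  · intro p hp; simpa using hp
  · intro p hp; simpa [hcomp] using hp
  · intro p _; simp [hcomp, hext]
  · intro p _; simp [hcomp, hext]

open scoped Classical in
/-- Place the vertices of colour below `col u` by `g` and every other vertex `v` at `x (col v)`.
The vertex `u` is obstructed if all edges of `F` then satisfy `Q`, but fewer than a `1 / Γ` fraction
of the possible new positions of `u` preserve this. -/
def Obstructed {S α : Type*} [Fintype α] [DecidableEq S] [DecidableEq α] {r : ℕ}
    (Q : Finset α → Prop) (Γ : ℕ) (col : S → Fin r) (u : S) (F : Finset (Finset S))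
    (x : Fin r → α) (g : S → α) : Prop :=
  (∀ e ∈ F, ∀ v ∈ e, v ≠ u → col v ≠ col u) ∧
  (∀ e ∈ F, Q (e.image fun v => if col v < col u then g v else x (col v))) ∧
  #{z | ∀ e ∈ F, Q (e.image (Function.update
    (fun v => if col v < col u then g v else x (col v)) u z))} * Γ < Fintype.card α

open scoped Classical in
theorem obstructed_image {S S' α : Type*} [Fintype α] [DecidableEq S] [DecidableEq S']
    [DecidableEq α] {r : ℕ} (ψ : S ↪ S')
    (Q : Finset α → Prop) (Γ : ℕ) (col : S' → Fin r) (u : S) (F : Finset (Finset S))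
    (x : Fin r → α) (g : S' → α) :
    Obstructed Q Γ col (ψ u) (F.image (image ψ)) x g ↔
      Obstructed Q Γ (col ∘ ψ) u F x (g ∘ ψ) := by
  have h (z) := Function.update_comp_eq_of_injective
    (fun v => if col v < col (ψ u) then g v else x (col v)) ψ.injective u z
  have hset (z : α) : (∀ e ∈ F.image (image ψ), Q (e.image (Function.update
      (fun v => if col v < col (ψ u) then g v else x (col v)) (ψ u) z))) ↔
      ∀ e ∈ F, Q (e.image (Function.update
        (fun v => if col (ψ v) < col (ψ u) then g (ψ v) else x (col (ψ v))) u z)) := by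
    simp only [forall_mem_image, image_image, h, Function.comp_def]
  refine and_congr (by simp) (and_congr ?_ ?_)
  · simp [image_image, Function.comp_def]
  · rw [filter_congr fun z _ => hset z]
    rfl

open scoped Classical in
theorem sum_card_obstructed_le {S α : Type*} [Fintype S] [Fintype α] [DecidableEq S]
    [DecidableEq α] {r : ℕ}
    (Q : Finset α → Prop) (Γ : ℕ) (col : S → Fin r) (u : S) (F : Finset (Finset S)) :
    (∑ x, #{g | Obstructed Q Γ col u F x g}) * Γ ≤
      Fintype.card α ^ r * Fintype.card α ^ Fintype.card S := by
  rcases isEmpty_or_nonempty α with hα | hα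
  · have : IsEmpty (Fin r → α) := ⟨fun x => hα.elim (x (col u))⟩
    simp
  have key (g : S → α) (x : Fin r → α) :
      #{z | Obstructed Q Γ col u F (Function.update x (col u) z) g} * Γ ≤ Fintype.card α := by
    by_cases hne : ∃ z, Obstructed Q Γ col u F (Function.update x (col u) z) g
    · obtain ⟨z₀, h1, h2, h3⟩ := hne
      refine (Nat.mul_le_mul_right _ (card_le_card fun z hz => ?_)).trans h3.le
      simp only [mem_filter, mem_univ, true_and] at hz ⊢
      intro e he
      convert hz.2.1 e he using 1
      refine image_congr fun v hv => ?_
      by_cases hvu : v = u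
      · subst hvu; simp
      · have := h1 e he v hv hvu
        simp [hvu, this]
    · push Not at hne
      simp [hne]
  have swap : ∑ x, #{g | Obstructed Q Γ col u F x g} =
      ∑ g : S → α, #{x | Obstructed Q Γ col u F x g} := by
    simp only [card_filter]; exact sum_comm
  have hpos : 0 < Fintype.card α := Fintype.card_pos
  rw [swap]
  have h (g : S → α) : #{x | Obstructed Q Γ col u F x g} * Γ ≤ Fintype.card α ^ r := by
    refine Nat.le_of_mul_le_mul_left ?_ hpos
    rw [← mul_assoc, ← sum_card_update (col u) (fun x => Obstructed Q Γ col u F x g)]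
    have swap' : ∑ z, #{x | Obstructed Q Γ col u F (Function.update x (col u) z) g} =
        ∑ x, #{z | Obstructed Q Γ col u F (Function.update x (col u) z) g} := by
      simp only [card_filter]; exact sum_comm
    rw [swap', sum_mul]
    refine (sum_le_card_nsmul _ _ _ fun x _ => key g x).trans ?_
    simp [mul_comm]
  rw [sum_mul]
  refine (sum_le_card_nsmul _ _ _ fun g _ => h g).trans ?_
  simp [mul_comm]

open scoped Classical in
/-- There are a colour `i` and a tuple `x`, monochromatic in colour `i`, for which every pattern on
`m` vertices is rarely obstructed. -/
theorem exists_good_tuple {α : Type*} [Fintype α] [DecidableEq α] [Nonempty α]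
    {k q r M : ℕ} (m : ℕ)
    (hM : ∀ χ : Finset (Fin M) → Fin q,
      ∃ i, ∃ g : Fin r ↪ Fin M, ∀ S : Finset (Fin r), #S = k → χ (S.map g) = i)
    (Γ : Fin r → ℕ) (χ : Finset α → Fin q) :
    ∃ i, ∃ x : Fin r → α, (∀ S : Finset (Fin r), #S = k → χ (S.image x) = i) ∧
      ∀ (col : Fin m → Fin r) (u : Fin m) (F : Finset (Finset (Fin m))),
        #{g : Fin m → α | Obstructed (χ · = i) (Γ (col u)) col u F x g} * Γ (col u) ≤
          (Fintype.card ((Fin r ↪ Fin M) × Fin q × (Fin m → Fin r) × Fin m ×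
            Finset (Finset (Fin m))) + 1) * Fintype.card α ^ m := by
  set I := (Fin r ↪ Fin M) × Fin q × (Fin m → Fin r) × Fin m × Finset (Finset (Fin m))
  set N := Fintype.card α with hN
  have hpos : 0 < N := Fintype.card_pos
  obtain ⟨bad, bad_iff⟩ : ∃ bad : Fin q × (Fin m → Fin r) × Fin m × Finset (Finset (Fin m)) →
      (Fin r → α) → Prop, ∀ p x, bad p x ↔ (Fintype.card I + 1) * N ^ m <
        #{g : Fin m → α | Obstructed (χ · = p.1) (Γ (p.2.1 p.2.2.1)) p.2.1 p.2.2.1 p.2.2.2 x g} *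
          Γ (p.2.1 p.2.2.1) := ⟨_, fun _ _ => Iff.rfl⟩
  have hbad (p) : #{x | bad p x} * (Fintype.card I + 1) ≤ N ^ r := by
    refine Nat.le_of_mul_le_mul_right ?_ (pow_pos hpos m)
    have h1 := card_nsmul_le_sum {x | bad p x} _ _ fun x hx => ((bad_iff _ _).1 (mem_filter.1 hx).2).le
    have h2 := sum_card_obstructed_le (α := α) (χ · = p.1) (Γ (p.2.1 p.2.2.1)) p.2.1 p.2.2.1 p.2.2.2
    rw [sum_mul, Fintype.card_fin] at h2
    rw [smul_eq_mul, ← mul_assoc] at h1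
    exact h1.trans ((sum_le_sum_of_subset (subset_univ _)).trans h2)
  have hbad' (a : I) : #{y : Fin M → α | bad a.2 (y ∘ a.1)} * (Fintype.card I + 1) ≤ N ^ M := by
    refine Nat.le_of_mul_le_mul_right ?_ (pow_pos hpos r)
    have h := card_comp_mul a.1 (bad a.2)
    simp only [Fintype.card_fin, ← hN] at h
    rw [mul_right_comm, h, mul_right_comm, mul_comm (N ^ M)]
    exact Nat.mul_le_mul_right _ (hbad _)
  obtain ⟨y, hy⟩ : ∃ y : Fin M → α, ∀ a : I, ¬ bad a.2 (y ∘ a.1) := by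
    by_contra! hcon
    have hcov : (univ : Finset (Fin M → α)) ⊆ univ.biUnion fun a : I => {y | bad a.2 (y ∘ a.1)} := by
      intro y _
      simpa using hcon y
    have h1 := (card_le_card hcov).trans card_biUnion_le
    have h2 := Nat.mul_le_mul_right (Fintype.card I + 1) h1
    rw [sum_mul, card_univ, Fintype.card_fun, Fintype.card_fin, ← hN] at h2
    have h3 := h2.trans (sum_le_card_nsmul _ _ _ fun a _ => hbad' a)
    rw [card_univ, smul_eq_mul] at h3
    have := pow_pos hpos M
    nlinarith
  obtain ⟨i, g, hg⟩ := hM fun S => χ (S.image y)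
  refine ⟨i, y ∘ g, fun S hS => ?_, fun col u F => not_lt.1 fun h =>
    hy (g, i, col, u, F) ((bad_iff _ _).2 h)⟩
  rw [← hg S hS, map_eq_image, image_image]

open scoped Classical in
theorem card_obstructed_mul_le {V α : Type*} [Fintype V] [DecidableEq V] [Fintype α]
    [DecidableEq α] [Nonempty α] {r m L Γ : ℕ} (Q : Finset α → Prop) (x : Fin r → α)
    (col : V → Fin r) (u : V) (F : Finset (Finset V))
    (h : ∀ (col' : Fin m → Fin r) (u' : Fin m) (F' : Finset (Finset (Fin m))), col' u' = col u →
      #{g : Fin m → α | Obstructed Q Γ col' u' F' x g} * Γ ≤ L * Fintype.card α ^ m)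
    (W : Finset V) (hu : u ∈ W) (hF : ∀ e ∈ F, e ⊆ W) (hW : #W ≤ m) :
    #{g : V → α | Obstructed Q Γ col u F x g} * Γ ≤ L * Fintype.card α ^ Fintype.card V := by
  have hpos : 0 < Fintype.card α := Fintype.card_pos
  obtain ⟨ψ⟩ : Nonempty (W ↪ Fin m) :=
    Function.Embedding.nonempty_of_card_le (by simpa using hW)
  let φ : W ↪ V := Function.Embedding.subtype _
  let FW : Finset (Finset W) := F.image fun e => e.subtype (· ∈ W)
  have hFW : FW.image (image φ) = F := by
    rw [image_image]
    refine (image_congr fun e he => ?_).trans image_id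
    ext v
    simp only [Function.comp_apply, mem_image, mem_subtype, id]
    exact ⟨by rintro ⟨a, ha, rfl⟩; exact ha, fun hv => ⟨⟨v, hF e he hv⟩, hv, rfl⟩⟩
  let col' : Fin m → Fin r := Function.extend ψ (col ∘ φ) fun _ => col u
  have hcol' : col' ∘ ψ = col ∘ φ := Function.extend_comp ψ.injective _ _
  have h1 := card_comp_mul φ (Obstructed Q Γ (col ∘ φ) ⟨u, hu⟩ FW x)
  have h2 := card_comp_mul ψ (Obstructed Q Γ (col' ∘ ψ) ⟨u, hu⟩ FW x)
  simp only [← obstructed_image] at h1 h2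
  rw [hFW] at h1
  rw [hcol', Fintype.card_fin] at h2
  have h3 := h col' (ψ ⟨u, hu⟩) (FW.image (image ψ)) (congrFun hcol' ⟨u, hu⟩)
  change #{g : V → α | Obstructed Q Γ col u F x g} * _ = _ at h1
  set a := #{g : V → α | Obstructed Q Γ col u F x g}
  set b := #{g : Fin m → α | Obstructed Q Γ col' (ψ ⟨u, hu⟩) (FW.image (image ψ)) x g}
  set c := #{h : W → α | Obstructed Q Γ (col ∘ φ) ⟨u, hu⟩ FW x h}
  have hs := pow_pos hpos (Fintype.card W)
  have hm := pow_pos hpos m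
  refine Nat.le_of_mul_le_mul_right ?_ (mul_pos hs hm)
  calc _ = (a * Fintype.card α ^ Fintype.card W) * (Γ * Fintype.card α ^ m) := by ring
    _ = (b * Γ) * (Fintype.card α ^ Fintype.card V * Fintype.card α ^ Fintype.card W) := by
      have h4 : c * Fintype.card α ^ Fintype.card V * (Γ * Fintype.card α ^ m) =
        (c * Fintype.card α ^ m) * (Γ * Fintype.card α ^ Fintype.card V) := by ring
      rw [h1, h4, ← h2]
      ring
    _ ≤ (L * Fintype.card α ^ m) * (Fintype.card α ^ Fintype.card V * _) :=
      Nat.mul_le_mul_right _ h3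
    _ = _ := by ring

open scoped Classical in
theorem sum_card_piecewise_insert {V α : Type*} [Fintype V] [Fintype α] [DecidableEq V]
    (X : (V → α) → Prop) {P : Finset V} {u : V} (hu : u ∉ P) (f : V → α) :
    ∑ z, #{g : V → α | X ((insert u P).piecewise (Function.update f u z) g)} =
      Fintype.card α * #{g : V → α | X (P.piecewise f g)} := by
  rw [← sum_card_update u]
  refine sum_congr rfl fun z _ => congrArg card (filter_congr fun g _ => ?_)
  rw [P.piecewise_insert, ← P.update_piecewise_of_notMem _ _ hu, Function.update_self,
    P.piecewise_congr (f := Function.update f u z) (f' := f) (g := g) (g' := g)]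
  · exact fun i hi => Function.update_of_ne (ne_of_mem_of_not_mem hi hu) _ _
  · exact fun i hi => rfl

open scoped Classical in
theorem obstructed_congr {S α : Type*} [Fintype α] [DecidableEq S] [DecidableEq α] {r : ℕ}
    {Q : Finset α → Prop} {Γ : ℕ} {col : S → Fin r} {u : S} {F : Finset (Finset S)}
    {x : Fin r → α} {g g' : S → α}
    (h : ∀ e ∈ F, ∀ v ∈ e, col v < col u → g v = g' v) :
    Obstructed Q Γ col u F x g ↔ Obstructed Q Γ col u F x g' := by
  have h1 (e) (he : e ∈ F) (v) (hv : v ∈ e) : (if col v < col u then g v else x (col v)) =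
      if col v < col u then g' v else x (col v) := by
    split_ifs with hc
    exacts [h e he v hv hc, rfl]
  refine and_congr Iff.rfl (and_congr (forall₂_congr fun e he => ?_) ?_)
  · rw [image_congr fun v hv => h1 e he v hv]
  · have h2 (z : α) :
        (∀ e ∈ F, Q (e.image (Function.update
          (fun v => if col v < col u then g v else x (col v)) u z))) ↔
        ∀ e ∈ F, Q (e.image (Function.update
          (fun v => if col v < col u then g' v else x (col v)) u z)) := by
      refine forall₂_congr fun e he => ?_
      rw [image_congr fun v hv => ?_]
      by_cases hvu : v = u
      · subst hvu; simp
      · simpa [hvu] using h1 e he v hv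
    rw [filter_congr fun z _ => h2 z]

open scoped Classical in
/-- If obstructions are rare, the map `x ∘ col` can be changed one vertex at a time, in order of
increasing colour, into an injective map all of whose edges still satisfy `Q`. -/
theorem exists_injective_of_card_obstructed_le {V α : Type*} [Fintype V] [DecidableEq V]
    [Fintype α] [DecidableEq α] [Nonempty α] {r D L : ℕ} (hD₀ : 0 < D) (hL : 0 < L)
    (H : Finset (Finset V)) (hD : ∀ u, #{v | ∃ e ∈ H, u ∈ e ∧ v ∈ e} ≤ D)
    (col : V → Fin r) (hcol : ∀ e ∈ H, ∀ u ∈ e, ∀ v ∈ e, u ≠ v → col u ≠ col v)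
    (Q : Finset α → Prop) (x : Fin r → α) (hx : ∀ e ∈ H, Q (e.image fun v => x (col v)))
    (Γ Λ : Fin r → ℕ)
    (hobs : ∀ u, #{g | Obstructed Q (Γ (col u)) col u {e ∈ H | u ∈ e} x g} * Γ (col u) ≤
      L * Fintype.card α ^ Fintype.card V)
    (hΛ₀ : ∀ c, 1 ≤ Λ c) (hΓ : ∀ c, L * Λ c ^ D < Γ c) (hΛ : ∀ c d, d < c → 2 * D * Γ d ≤ Λ c)
    (hN : ∀ c, 2 * Fintype.card V * Γ c < Fintype.card α) :
    ∃ f : V → α, Function.Injective f ∧ ∀ e ∈ H, Q (e.image f) := by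
  set N := Fintype.card α with hNdef
  have hpos : 0 < N := Fintype.card_pos
  have hNV : 0 < N ^ Fintype.card V := pow_pos hpos _
  let B (u : V) : (V → α) → Prop := Obstructed Q (Γ (col u)) col u {e ∈ H | u ∈ e} x
  let dep (u : V) : Finset V := {v | (∃ e ∈ H, u ∈ e ∧ v ∈ e) ∧ col v < col u}
  have hdep (u) : #(dep u) ≤ D := (card_le_card fun v hv => by
    simp only [dep, mem_filter] at hv ⊢; exact ⟨hv.1, hv.2.1⟩).trans (hD u)
  have hB {u : V} {g g' : V → α} (h : ∀ v ∈ dep u, g v = g' v) : B u g ↔ B u g' :=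
    obstructed_congr fun e he v hv hc => h v (by
      simp only [dep, mem_filter, mem_univ, true_and] at he ⊢
      exact ⟨⟨e, he.1, he.2, hv⟩, hc⟩)
  suffices h : ∀ t ≤ Fintype.card V, ∃ (P : Finset V) (f : V → α), #P = t ∧
      (∀ v ∈ P, ∀ w, col w < col v → w ∈ P) ∧ Set.InjOn f P ∧ (∀ v ∉ P, f v = x (col v)) ∧
      (∀ e ∈ H, Q (e.image f)) ∧
      ∀ u ∉ P, #{g | B u (P.piecewise f g)} * Γ (col u) ≤
        L * Λ (col u) ^ #(P ∩ dep u) * N ^ Fintype.card V by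
    obtain ⟨P, f, hP, -, hinj, -, hQ, -⟩ := h _ le_rfl
    rw [(card_eq_iff_eq_univ P).1 hP, coe_univ] at hinj
    exact ⟨f, Set.injOn_univ.1 hinj, hQ⟩
  intro t
  induction t with
  | zero =>
    intro _
    refine ⟨∅, fun v => x (col v), rfl, by simp, by simp, by simp, hx, fun u _ => ?_⟩
    simpa using hobs u
  | succ t ih =>
    intro ht
    obtain ⟨P, f, hP, hdown, hinj, hoff, hQ, hcond⟩ := ih (by omega)
    obtain ⟨u, hu, hmin⟩ := exists_min_image Pᶜ col (card_pos.1 (by rw [card_compl]; omega))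
    rw [mem_compl] at hu
    have hlow (w) (hw : col w < col u) : w ∈ P := by
      by_contra h
      exact absurd hw (not_lt.2 (hmin w (mem_compl.2 h)))
    have hdepP : dep u ⊆ P := fun v hv => hlow v (mem_filter.1 hv).2.2
    have hnotB : ¬ B u f := by
      intro h
      have h1 := hcond u hu
      rw [filter_true_of_mem fun g _ => (hB fun v hv =>
        (P.piecewise_eq_of_mem f g (hdepP hv)).symm).1 h, card_univ, Fintype.card_fun,
        inter_eq_right.2 hdepP, mul_comm] at h1
      have h2 := Nat.le_of_mul_le_mul_right h1 hNV
      exact absurd (hΓ (col u)) (not_lt.2 (h2.trans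
        (Nat.mul_le_mul_left _ (Nat.pow_le_pow_right (hΛ₀ _) (hdep u)))))
    have hmix (e) (he : e ∈ ({e ∈ H | u ∈ e} : Finset _)) (v) (hv : v ∈ e) :
        (if col v < col u then f v else x (col v)) = f v := by
      rw [mem_filter] at he
      split_ifs with hc
      · rfl
      · by_cases hvu : v = u
        · rw [hvu, hoff u hu]
        · refine (hoff v fun hvP => hu (hdown v hvP u ?_)).symm
          exact lt_of_le_of_ne (not_lt.1 hc) (hcol e he.1 u he.2 v hv (Ne.symm hvu))
    let Z : Finset α := {z | ∀ e ∈ H, u ∈ e → Q (e.image (Function.update f u z))}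
    have hZ : N ≤ #Z * Γ (col u) := by
      by_contra hlt
      refine hnotB ⟨fun e he v hv hvu => ?_, fun e he => ?_, ?_⟩
      · rw [mem_filter] at he
        exact hcol e he.1 v hv u he.2 hvu
      · rw [image_congr fun v hv => hmix e he v hv]
        exact hQ e (mem_filter.1 he).1
      · rw [not_le] at hlt
        have hZ' (z : α) : (∀ e ∈ ({e ∈ H | u ∈ e} : Finset _), Q (e.image (Function.update
            (fun v => if col v < col u then f v else x (col v)) u z))) ↔
            ∀ e ∈ H, u ∈ e → Q (e.image (Function.update f u z)) := by
          simp only [mem_filter, and_imp]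
          refine forall₃_congr fun e he hue => ?_
          rw [image_congr fun v hv => ?_]
          by_cases hvu : v = u
          · subst hvu; simp
          · simpa [hvu] using hmix e (mem_filter.2 ⟨he, hue⟩) v hv
        simp only [hZ']
        convert hlt
    let Y : Finset V := {w | (∃ e ∈ H, u ∈ e ∧ w ∈ e) ∧ col u < col w ∧ w ∉ P}
    have hY : #Y ≤ D := (card_le_card fun v hv => by
      simp only [Y, mem_filter] at hv ⊢; exact ⟨hv.1, hv.2.1⟩).trans (hD u)
    have hYdep (w) (hw : w ∈ Y) : u ∈ dep w := by
      simp only [Y, dep, mem_filter, mem_univ, true_and] at hw ⊢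
      obtain ⟨⟨e, he, hue, hwe⟩, hc, -⟩ := hw
      exact ⟨⟨e, he, hwe, hue⟩, hc⟩
    let bad (w : V) : Finset α := {z | L * Λ (col w) ^ (#(P ∩ dep w) + 1) * N ^ Fintype.card V <
      #{g | B w ((insert u P).piecewise (Function.update f u z) g)} * Γ (col w)}
    have hbad (w) (hw : w ∈ Y) : #(bad w) * (2 * D * Γ (col u)) ≤ N := by
      obtain ⟨-, -, hc, hwP⟩ := mem_filter.1 hw
      refine (Nat.mul_le_mul_left _ (hΛ _ _ hc)).trans ?_
      have h1 := card_nsmul_le_sum (bad w) _ _ fun z hz => (mem_filter.1 hz).2.le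
      have h2 := h1.trans (sum_le_sum_of_subset (subset_univ _))
      rw [← sum_mul, sum_card_piecewise_insert (B w) hu, smul_eq_mul,
        mul_assoc (Fintype.card α)] at h2
      have h3 := h2.trans (Nat.mul_le_mul_left _ (hcond w hwP))
      have hl : 0 < L * Λ (col w) ^ #(P ∩ dep w) * N ^ Fintype.card V :=
        mul_pos (mul_pos hL (pow_pos (hΛ₀ _) _)) hNV
      refine Nat.le_of_mul_le_mul_right (Eq.trans_le ?_ h3) hl
      rw [pow_succ]; ring
    obtain ⟨z, hzZ, hz⟩ : ∃ z ∈ Z, z ∉ Y.biUnion bad ∪ P.image f := by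
      refine exists_mem_notMem_of_card_lt_card ?_
      by_contra hle
      rw [not_lt] at hle
      have h1 : #(Y.biUnion bad) * (2 * D * Γ (col u)) ≤ D * N := by
        refine (Nat.mul_le_mul_right _ card_biUnion_le).trans ?_
        rw [sum_mul]
        exact (sum_le_card_nsmul _ _ _ hbad).trans (Nat.mul_le_mul_right _ hY)
      have h2 : 2 * (#(Y.biUnion bad) * Γ (col u)) ≤ N := by
        refine Nat.le_of_mul_le_mul_left ?_ hD₀
        refine Eq.trans_le ?_ h1
        ring
      have h3 : #Z ≤ #(Y.biUnion bad) + Fintype.card V :=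
        hle.trans ((card_union_le _ _).trans
          (Nat.add_le_add_left (card_image_le.trans (card_le_univ _)) _))
      have h4 := hZ.trans (Nat.mul_le_mul_right _ h3)
      have h5 := hN (col u)
      nlinarith
    simp only [mem_union, mem_biUnion, mem_image, not_or, not_exists, not_and] at hz
    refine ⟨insert u P, Function.update f u z, by rw [card_insert_of_notMem hu, hP], ?_, ?_, ?_,
      ?_, ?_⟩
    · intro v hv w hw
      rcases mem_insert.1 hv with rfl | hv
      · exact mem_insert_of_mem (hlow w hw)
      · exact mem_insert_of_mem (hdown v hv w hw)
    · have hup (v) (hv : v ∈ P) : Function.update f u z v = f v :=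
        Function.update_of_ne (ne_of_mem_of_not_mem hv hu) _ _
      rw [coe_insert, Set.injOn_insert (mem_coe.not.2 hu)]
      refine ⟨(Set.EqOn.injOn_iff fun v hv => hup v hv).2 hinj, ?_⟩
      rintro ⟨v, hv, hvz⟩
      rw [Function.update_self, hup v hv] at hvz
      exact hz.2 v hv hvz
    · intro v hv
      rw [mem_insert, not_or] at hv
      rw [Function.update_of_ne hv.1, hoff v hv.2]
    · intro e he
      by_cases hue : u ∈ e
      · exact (mem_filter.1 hzZ).2 e he hue
      · rw [image_congr fun v hv => Function.update_of_ne (ne_of_mem_of_not_mem hv hue) _ _]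
        exact hQ e he
    · intro w hw
      rw [mem_insert, not_or] at hw
      by_cases hwu : u ∈ dep w
      · have hwY : w ∈ Y := by
          simp only [Y, dep, mem_filter, mem_univ, true_and] at hwu ⊢
          obtain ⟨⟨e, he, hwe, hue⟩, hc⟩ := hwu
          exact ⟨⟨e, he, hue, hwe⟩, hc, hw.2⟩
        rw [insert_inter_of_mem hwu, card_insert_of_notMem fun h => hu (mem_inter.1 h).1]
        simpa [bad] using hz.1 w hwY
      · rw [insert_inter_of_notMem hwu]
        refine (Eq.le ?_).trans (hcond w hw.2)
        congr 2
        refine filter_congr fun g _ => hB fun v hv => ?_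
        have hvu : v ≠ u := fun h => hwu (h ▸ hv)
        by_cases hvP : v ∈ P <;> simp [Finset.piecewise, hvu, hvP]

theorem exists_threshold_sequences (D L : ℕ) :
    ∃ Γ Λ : ℕ → ℕ, (∀ c, 1 ≤ Λ c) ∧ (∀ c, L * Λ c ^ D < Γ c) ∧
      ∀ c d, d < c → 2 * D * Γ d ≤ Λ c := by
  let Λ : ℕ → ℕ := Nat.rec 1 fun _ l => l + 2 * D * (L * l ^ D + 1)
  have hsucc (c) : Λ (c + 1) = Λ c + 2 * D * (L * Λ c ^ D + 1) := rfl
  have hmono : Monotone Λ := monotone_nat_of_le_succ fun c => by rw [hsucc]; omega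
  refine ⟨fun c => L * Λ c ^ D + 1, Λ, fun c => hmono (Nat.zero_le c), fun c => Nat.lt_succ_self _,
    fun c d hdc => le_trans ?_ (hmono (Nat.succ_le_of_lt hdc))⟩
  rw [Nat.succ_eq_add_one, hsucc]
  exact Nat.le_add_left _ _

/-- For all positive integers Δ, k and q there is a constant c(Δ,k,q) such that
if H_1,...,H_q are k-uniform hypergraphs each with n vertices and maximum degree at most Δ,
then r(H_1,...,H_q) ≤ c(Δ,k,q)·n: every q-colouring of the k-subsets of a vertex set of size
N ≥ c(Δ,k,q)·n contains, for some colour i, a copy of H_i all of whose edges have colour i. -/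
theorem stmt_6 :
    ∀ Δ k q : ℕ, 0 < Δ → 0 < k → 0 < q →
    ∃ c : ℕ, 0 < c ∧
      ∀ (n : ℕ) (H : Fin q → Finset (Finset (Fin n))),
        (∀ i : Fin q, ∀ e ∈ H i, e.card = k) →
        (∀ i : Fin q, ∀ v : Fin n, ((H i).filter fun e => v ∈ e).card ≤ Δ) →
        ∀ N : ℕ, c * n ≤ N →
          ∀ χ : Finset (Fin N) → Fin q,
            ∃ i : Fin q, ∃ f : Fin n → Fin N, Function.Injective f ∧
              ∀ e ∈ H i, χ (e.image f) = i := by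
  classical
  intro Δ k q _ hk hq
  obtain ⟨M, hM⟩ := exists_ramsey k q (Δ * k + 1 + 1)
  obtain ⟨Γ, Λ, hΛ₀, hΓ, hΛ⟩ := exists_threshold_sequences (Δ * k + 1)
    (Fintype.card ((Fin (Δ * k + 1 + 1) ↪ Fin M) × Fin q ×
      (Fin (Δ * k + 1) → Fin (Δ * k + 1 + 1)) × Fin (Δ * k + 1) ×
        Finset (Finset (Fin (Δ * k + 1)))) + 1)
  refine ⟨∑ c : Fin (Δ * k + 1 + 1), 2 * Γ c + 1, by omega, fun n H hH hdeg N hN χ => ?_⟩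
  rcases Nat.eq_zero_or_pos n with rfl | hn
  · refine ⟨⟨0, hq⟩, finZeroElim, fun a => a.elim0, fun e he => ?_⟩
    have h := hH _ e he
    rw [eq_empty_of_isEmpty e, card_empty] at h
    omega
  have hN₀ : 0 < N := (Nat.mul_pos (Nat.succ_pos _) hn).trans_le hN
  have : NeZero N := ⟨hN₀.ne'⟩
  obtain ⟨i, x, hx, hobs⟩ := exists_good_tuple (α := Fin N) (Δ * k + 1) hM (fun c => Γ c) χ
  have hnbhd (u : Fin n) : #{v | ∃ e ∈ H i, u ∈ e ∧ v ∈ e} ≤ Δ * k := by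
    have hsub : ({v | ∃ e ∈ H i, u ∈ e ∧ v ∈ e} : Finset (Fin n)) ⊆
        {e ∈ H i | u ∈ e}.biUnion id := by
      intro v hv
      obtain ⟨e, he, hue, hve⟩ := (mem_filter.1 hv).2
      exact mem_biUnion.2 ⟨e, mem_filter.2 ⟨he, hue⟩, hve⟩
    refine (card_le_card hsub).trans ((card_biUnion_le_card_mul _ _ k fun e he =>
      (hH i e (mem_filter.1 he).1).le).trans (Nat.mul_le_mul_right _ (hdeg i u)))
  obtain ⟨col, hcol⟩ := exists_coloring_of_card_le (Δ * k + 1)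
    (fun u v => ∃ e ∈ H i, u ∈ e ∧ v ∈ e) (fun u v ⟨e, he, hu, hv⟩ => ⟨e, he, hv, hu⟩)
    (fun u => (hnbhd u).trans (Nat.le_succ _))
  have hcol' (e) (he : e ∈ H i) (u) (hu : u ∈ e) (v) (hv : v ∈ e) (huv : u ≠ v) :
      col u ≠ col v := hcol u v huv ⟨e, he, hu, hv⟩
  refine ⟨i, exists_injective_of_card_obstructed_le (Nat.succ_pos (Δ * k)) (Nat.succ_pos _) (H i)
    (fun u => (hnbhd u).trans (Nat.le_succ _)) col hcol' (χ · = i) x (fun e he => ?_)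
    (fun c => Γ c) (fun c => Λ c) (fun u => ?_) (fun c => hΛ₀ c) (fun c => hΓ c)
    (fun c d hdc => hΛ c d hdc) fun c => ?_⟩
  · rw [← hx (e.image col), image_image]
    · rfl
    · rw [card_image_of_injOn, hH i e he]
      exact fun u hu v hv huv => by_contra fun h => hcol' e he u hu v hv h huv
  · refine card_obstructed_mul_le (m := Δ * k + 1) _ x col u _ (fun col' u' F' hu' => ?_)
      (insert u ({v | ∃ e ∈ H i, u ∈ e ∧ v ∈ e} : Finset (Fin n))) (mem_insert_self _ _)
      (fun e he v hv => ?_) ((card_insert_le _ _).trans (Nat.succ_le_succ (hnbhd u)))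
    · rw [← hu']
      exact hobs col' u' F'
    · rw [mem_filter] at he
      exact mem_insert_of_mem (mem_filter.2 ⟨mem_univ _, e, he.1, he.2, hv⟩)
  · rw [Fintype.card_fin, Fintype.card_fin]
    refine lt_of_lt_of_le ?_ hN
    have h := single_le_sum (f := fun c : Fin (Δ * k + 1 + 1) => 2 * Γ c)
      (fun _ _ => Nat.zero_le _) (mem_univ c)
    calc 2 * n * Γ c = (2 * Γ c) * n := by ring
      _ < _ := Nat.mul_lt_mul_of_pos_right (Nat.lt_succ_of_le h) hn
end

section
/- There is a constant c > 0 such that for each sufficiently large Δ there is a 3-uniform hypergraph H with n vertices and maximum degree at most Δ for which the 4-colour Ramsey number satisfies r(H,H,H,H) ≥ 2^{2^{cΔ}}·n. -/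
open Finset

/-- The Erdős lower bound for graph Ramsey numbers: if `2 * C(|L|, k) < 2 ^ C(k, 2)`, some
2-colouring of the pairs from `L` has no monochromatic clique of size `k`. -/
theorem exists_coloring_no_mono_clique {L : Type*} [Fintype L] [DecidableEq L] (k : ℕ)
    (hk : 2 * (Fintype.card L).choose k < 2 ^ (k.choose 2)) :
    ∃ g : Finset L → Bool, ∀ c : Bool, ¬∃ S : Finset L, S.card = k ∧
      ∀ a ∈ S, ∀ b ∈ S, a ≠ b → g {a, b} = c := by
  classical
  by_contra! hcon
  let constOn : Finset L × Bool → Finset (Finset L → Bool) := fun q =>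
    Fintype.piFinset fun p => if p ∈ powersetCard 2 q.1 then {q.2} else univ
  have card_constOn : ∀ q ∈ powersetCard k (univ : Finset L) ×ˢ (univ : Finset Bool),
      (constOn q).card * 2 ^ (k.choose 2) = 2 ^ Fintype.card (Finset L) := by
    rintro ⟨S, c⟩ hq
    have hS : S.card = k := (mem_powersetCard.1 (mem_product.1 hq).1).2
    have hcard : (constOn (S, c)).card =
        2 ^ (univ.filter fun p => p ∉ powersetCard 2 S).card := by
      simp only [constOn, Fintype.card_piFinset]
      rw [← prod_const, prod_filter]
      refine prod_congr rfl fun p _ => ?_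
      by_cases hp : p ∈ powersetCard 2 S
      · rw [if_pos hp, if_neg (not_not.2 hp), card_singleton]
      · rw [if_neg hp, if_pos hp, card_univ, Fintype.card_bool]
    rw [hcard, ← pow_add]
    congr 1
    have h := card_filter_add_card_filter_not (s := (univ : Finset (Finset L)))
      (fun p => p ∈ powersetCard 2 S)
    rw [filter_mem_eq_inter, univ_inter, card_powersetCard, hS] at h
    rw [← card_univ]
    omega
  have hcover : (univ : Finset (Finset L → Bool)) ⊆
      (powersetCard k (univ : Finset L) ×ˢ (univ : Finset Bool)).biUnion constOn := by
    intro g _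
    obtain ⟨c, S, hS, hg⟩ := hcon g
    refine mem_biUnion.2 ⟨(S, c), by simp [hS], Fintype.mem_piFinset.2 fun p => ?_⟩
    split_ifs with hp
    · obtain ⟨hpS, hp2⟩ := mem_powersetCard.1 hp
      obtain ⟨a, b, hab, rfl⟩ := card_eq_two.1 hp2
      exact mem_singleton.2 (hg a (hpS (by simp)) b (hpS (by simp)) hab)
    · exact mem_univ _
  have hle := (card_le_card hcover).trans card_biUnion_le
  have hsum : (∑ q ∈ powersetCard k (univ : Finset L) ×ˢ (univ : Finset Bool),
      (constOn q).card) * 2 ^ (k.choose 2) =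
      2 * (Fintype.card L).choose k * 2 ^ Fintype.card (Finset L) := by
    rw [sum_mul, sum_congr rfl card_constOn, sum_const, card_product, card_powersetCard,
      card_univ, card_univ, Fintype.card_bool, smul_eq_mul]
    ring
  rw [card_univ, Fintype.card_fun, Fintype.card_bool] at hle
  have h1 := Nat.mul_le_mul_right (2 ^ (k.choose 2)) hle
  rw [hsum] at h1
  have h2 := Nat.mul_lt_mul_of_pos_right hk (pow_pos two_pos (Fintype.card (Finset L)))
  rw [mul_comm] at h1
  omega

/-- The case of `exists_coloring_no_mono_clique` with `2 ^ t` vertices and `k = 4 * t`. -/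
theorem exists_coloring_two_pow (t : ℕ) (ht : 1 ≤ t) :
    ∃ g : Finset (Fin (2 ^ t)) → Bool, ∀ c : Bool, ¬∃ S : Finset (Fin (2 ^ t)),
      S.card = 4 * t ∧ ∀ a ∈ S, ∀ b ∈ S, a ≠ b → g {a, b} = c := by
  apply exists_coloring_no_mono_clique
  rw [Fintype.card_fin]
  have hchoose : (4 * t).choose 2 = 2 * t * (4 * t - 1) := by
    rw [Nat.choose_two_right]
    apply Nat.div_eq_of_eq_mul_left two_pos
    ring
  calc 2 * (2 ^ t).choose (4 * t) ≤ 2 * (2 ^ t) ^ (4 * t) := by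
        gcongr
        exact Nat.choose_le_pow _ _
    _ = 2 ^ (t * (4 * t) + 1) := by rw [← pow_mul, pow_succ, mul_comm]
    _ < 2 ^ ((4 * t).choose 2) := by
        apply Nat.pow_lt_pow_right one_lt_two
        rw [hchoose]
        obtain ⟨s, rfl⟩ := Nat.exists_eq_add_of_le ht
        have : 4 * (1 + s) - 1 = 4 * s + 3 := by omega
        rw [this]
        nlinarith

theorem exists_div_two_pow_eq (x y : ℕ) : ∃ d, x / 2 ^ d = y / 2 ^ d := by
  refine ⟨x + y, ?_⟩
  have h : x + y < 2 ^ (x + y) := Nat.lt_two_pow_self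
  rw [Nat.div_eq_of_lt (by omega), Nat.div_eq_of_lt (by omega)]

/-- One more than the position of the highest binary digit in which `x` and `y` differ
(and `0` if `x = y`). -/
noncomputable def diffLevel (x y : ℕ) : ℕ := Nat.find (exists_div_two_pow_eq x y)

theorem diffLevel_le_iff {x y d : ℕ} : diffLevel x y ≤ d ↔ x / 2 ^ d = y / 2 ^ d := by
  constructor
  · intro h
    obtain ⟨e, rfl⟩ := Nat.exists_eq_add_of_le h
    rw [pow_add, ← Nat.div_div_eq_div_mul, ← Nat.div_div_eq_div_mul]
    exact congrArg (· / 2 ^ e) (Nat.find_spec (exists_div_two_pow_eq x y))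
  · exact fun h => Nat.find_min' _ h

theorem diffLevel_comm (x y : ℕ) : diffLevel x y = diffLevel y x :=
  eq_of_forall_ge_iff fun d => by rw [diffLevel_le_iff, diffLevel_le_iff, eq_comm]

theorem diffLevel_pos {x y : ℕ} (h : x ≠ y) : 0 < diffLevel x y := by
  by_contra! h0
  rw [diffLevel_le_iff] at h0
  simp at h0
  exact h h0

theorem diffLevel_eq_max {x y z : ℕ} (hxy : x < y) (hyz : y < z) :
    diffLevel x z = max (diffLevel x y) (diffLevel y z) :=
  eq_of_forall_ge_iff fun d => by
    rw [max_le_iff, diffLevel_le_iff, diffLevel_le_iff, diffLevel_le_iff]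
    have h1 := Nat.div_le_div_right (c := 2 ^ d) hxy.le
    have h2 := Nat.div_le_div_right (c := 2 ^ d) hyz.le
    omega

theorem diffLevel_ne {x y z : ℕ} (hxy : x < y) (hyz : y < z) :
    diffLevel x y ≠ diffLevel y z := by
  intro h
  obtain ⟨d, hd⟩ := Nat.exists_eq_succ_of_ne_zero (diffLevel_pos hxy.ne).ne'
  have h1 : ¬diffLevel x y ≤ d := by omega
  have h2 : ¬diffLevel y z ≤ d := by omega
  have h3 : diffLevel x y ≤ d + 1 := by omega
  have h4 : diffLevel y z ≤ d + 1 := by omega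
  rw [diffLevel_le_iff] at h1 h2 h3 h4
  rw [pow_succ, ← Nat.div_div_eq_div_mul, ← Nat.div_div_eq_div_mul] at h3 h4
  have h5 := Nat.div_le_div_right (c := 2 ^ d) hxy.le
  have h6 := Nat.div_le_div_right (c := 2 ^ d) hyz.le
  omega

/-- The level at which two leaves of the binary tree with `2 ^ M` leaves separate. -/
theorem exists_level_function (M : ℕ) (hM : 0 < M) :
    ∃ δ : Fin (2 ^ M) → Fin (2 ^ M) → Fin M, (∀ x y, δ x y = δ y x) ∧
      (∀ x y z, x < y → y < z → δ x z = max (δ x y) (δ y z)) ∧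
      ∀ x y z, x < y → y < z → δ x y ≠ δ y z := by
  have hle : ∀ x y : Fin (2 ^ M), diffLevel x y ≤ M := fun x y => by
    rw [diffLevel_le_iff, Nat.div_eq_of_lt x.2, Nat.div_eq_of_lt y.2]
  refine ⟨fun x y => ⟨diffLevel x y - 1, by have := hle x y; omega⟩, ?_, ?_, ?_⟩
  · intro x y
    simp only [diffLevel_comm]
  · intro x y z hxy hyz
    have h := diffLevel_eq_max hxy hyz
    apply Fin.ext
    rw [Fin.coe_max]
    dsimp only
    omega
  · intro x y z hxy hyz heq
    have h := diffLevel_ne hxy hyz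
    have h1 := diffLevel_pos (Fin.val_ne_of_ne hxy.ne)
    have h2 := diffLevel_pos (Fin.val_ne_of_ne hyz.ne)
    have h3 := congrArg Fin.val heq
    dsimp only at h3
    omega

/-- The edge `{(i, false), (i, true), v}` of the hypergraph on `ι × Bool` whose edges are the
fibres over `ι` extended by one further vertex. -/
def fibreEdge {ι : Type*} [DecidableEq ι] (i : ι) (v : ι × Bool) : Finset (ι × Bool) :=
  {(i, false), (i, true), v}

/-- If all fibre edges are mapped to triples `x < y < z` with `δ x y < δ y z` and with the pair
of levels coloured `c`, then the levels contain a clique of colour `c` with one vertex fewer than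
there are fibres. -/
theorem exists_mono_clique_of_increasing {α L ι : Type*} [LinearOrder α] [LinearOrder L]
    [Fintype ι] [Nonempty ι] [DecidableEq ι] (δ : α → α → L)
    (hmax : ∀ x y z, x < y → y < z → δ x z = max (δ x y) (δ y z))
    (g : Finset L → Bool) (c : Bool) (f : ι × Bool → α) (hf : Function.Injective f)
    (hmono : ∀ i v, v.1 ≠ i → ∀ x y z, x < y → y < z →
      (fibreEdge i v).image f = {x, y, z} → δ x y < δ y z ∧ g {δ x y, δ y z} = c) :
    ∃ S : Finset L, S.card = Fintype.card ι - 1 ∧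
      ∀ a ∈ S, ∀ b ∈ S, a ≠ b → g {a, b} = c := by
  obtain ⟨v₀, hv₀⟩ := Finite.exists_min f
  have hordered : ∀ i, ∃ s, f (i, !s) < f (i, s) := fun i => by
    rcases lt_trichotomy (f (i, false)) (f (i, true)) with h | h | h
    · exact ⟨true, h⟩
    · simpa using hf h
    · exact ⟨false, h⟩
  choose top htop using hordered
  have hedge : ∀ i v, (fibreEdge i v).image f = {f (i, !top i), f (i, top i), f v} := by
    intro i v
    rw [fibreEdge, image_insert, image_insert, image_singleton]
    cases top i
    · exact Finset.insert_comm _ _ _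
    · rfl
  have hlevel : ∀ i, i ≠ v₀.1 →
      δ (f v₀) (f (i, top i)) = δ (f (i, !top i)) (f (i, top i)) := by
    intro i hi
    have hlt : f v₀ < f (i, !top i) :=
      lt_of_le_of_ne (hv₀ _) fun h => hi (congrArg Prod.fst (hf h)).symm
    rw [hmax _ _ _ hlt (htop i), max_eq_right]
    refine (hmono i v₀ hi.symm _ _ _ hlt (htop i) ?_).1.le
    rw [hedge]
    ext
    simp only [mem_insert, mem_singleton]
    tauto
  have hpair : ∀ i j, i ≠ v₀.1 → j ≠ v₀.1 → f (i, top i) < f (j, top j) →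
      δ (f v₀) (f (i, top i)) < δ (f v₀) (f (j, top j)) ∧
      g {δ (f v₀) (f (i, top i)), δ (f v₀) (f (j, top j))} = c := by
    intro i j hi hj hij
    have hne : j ≠ i := by
      rintro rfl
      exact lt_irrefl _ hij
    have h := hmono i (j, top j) hne _ _ _ (htop i) hij (hedge i _)
    have hlt : f v₀ < f (i, top i) :=
      lt_of_le_of_ne (hv₀ _) fun h => hi (congrArg Prod.fst (hf h)).symm
    have hj' := hmax _ _ _ hlt hij
    rw [hlevel i hi, max_eq_right h.1.le] at hj'
    rw [hlevel i hi, hj']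
    exact h
  have hcases : ∀ i j, i ≠ j → f (i, top i) < f (j, top j) ∨ f (j, top j) < f (i, top i) :=
    fun i j hij => lt_or_gt_of_ne fun h => hij (congrArg Prod.fst (hf h))
  refine ⟨(univ.erase v₀.1).image fun i => δ (f v₀) (f (i, top i)), ?_, ?_⟩
  · rw [card_image_of_injOn, card_erase_of_mem (mem_univ _), card_univ]
    intro i hi j hj hij
    have hi' := (mem_erase.1 hi).1
    have hj' := (mem_erase.1 hj).1
    by_contra hne
    rcases hcases i j hne with h | h
    · exact (hpair i j hi' hj' h).1.ne hij
    · exact (hpair j i hj' hi' h).1.ne hij.symm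
  · intro a ha b hb hab
    obtain ⟨i, hi, rfl⟩ := mem_image.1 ha
    obtain ⟨j, hj, rfl⟩ := mem_image.1 hb
    have hi' := (mem_erase.1 hi).1
    have hj' := (mem_erase.1 hj).1
    have hne : i ≠ j := by
      rintro rfl
      exact hab rfl
    rcases hcases i j hne with h | h
    · exact (hpair i j hi' hj' h).2
    · rw [pair_comm]
      exact (hpair j i hj' hi' h).2

/-- Stepping up: a 2-colouring of the pairs of levels induces a 4-colouring of the triples of
leaves. -/
theorem exists_coloring_no_mono_fibreEdge (t : ℕ) (ht : 1 ≤ t) :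
    ∃ χ : Finset (Fin (2 ^ 2 ^ t)) → Fin 4,
      ∀ f : Fin (4 * t + 1) × Bool → Fin (2 ^ 2 ^ t), Function.Injective f → ∀ k : Fin 4,
        ¬∀ i v, v.1 ≠ i → χ ((fibreEdge i v).image f) = k := by
  obtain ⟨g, hg⟩ := exists_coloring_two_pow t ht
  obtain ⟨δ, hsymm, hmax, hne⟩ := exists_level_function (2 ^ t) (by positivity)
  let enc : Bool × Bool ≃ Fin 4 := Fintype.equivFinOfCardEq (by simp)
  let χ : Finset (Fin (2 ^ 2 ^ t)) → Fin 4 := fun e =>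
    match e.sort with
    | [x, y, z] => enc (decide (δ x y < δ y z), g {δ x y, δ y z})
    | _ => 0
  have hχ : ∀ x y z, x < y → y < z →
      χ {x, y, z} = enc (decide (δ x y < δ y z), g {δ x y, δ y z}) := by
    intro x y z hxy hyz
    have hsort : ({x, y, z} : Finset (Fin (2 ^ 2 ^ t))).sort = [x, y, z] := by
      rw [sort_insert, sort_insert, sort_singleton] <;> grind
    simp only [χ, hsort]
  refine ⟨χ, fun f hf k hmono => ?_⟩
  obtain ⟨⟨s, c⟩, rfl⟩ := enc.surjective k
  have hcol : ∀ i v, v.1 ≠ i → ∀ x y z, x < y → y < z →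
      (fibreEdge i v).image f = {x, y, z} →
      decide (δ x y < δ y z) = s ∧ g {δ x y, δ y z} = c := by
    intro i v hv x y z hxy hyz he
    have h := hmono i v hv
    rw [he, hχ x y z hxy hyz] at h
    simpa using enc.injective h
  have hcard : Fintype.card (Fin (4 * t + 1)) - 1 = 4 * t := by simp
  cases s with
  | true =>
    have h := exists_mono_clique_of_increasing δ hmax g c f hf
      fun i v hv x y z hxy hyz he => by simpa using hcol i v hv x y z hxy hyz he
    rw [hcard] at h
    exact hg c h
  | false =>
    have hswap : ∀ x y z : Fin (2 ^ 2 ^ t), ({x, y, z} : Finset _) = {z, y, x} := by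
      intro x y z
      ext
      simp only [mem_insert, mem_singleton]
      tauto
    have h := exists_mono_clique_of_increasing (α := (Fin (2 ^ 2 ^ t))ᵒᵈ)
      (fun x y => δ (OrderDual.ofDual x) (OrderDual.ofDual y))
      (fun x y z hxy hyz => by
        rw [hsymm (OrderDual.ofDual x) (OrderDual.ofDual z),
          hsymm (OrderDual.ofDual x) (OrderDual.ofDual y),
          hsymm (OrderDual.ofDual y) (OrderDual.ofDual z), max_comm]
        exact hmax _ _ _ hyz hxy)
      g c (fun v => OrderDual.toDual (f v)) hf
      fun i v hv x y z hxy hyz he => by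
        have hrev : (fibreEdge i v).image f =
            {OrderDual.ofDual z, OrderDual.ofDual y, OrderDual.ofDual x} :=
          Eq.trans he (hswap _ _ _)
        have h := hcol i v hv _ _ _ hyz hxy hrev
        have hn := hne _ _ _ hyz hxy
        rw [hsymm (OrderDual.ofDual x) (OrderDual.ofDual y),
          hsymm (OrderDual.ofDual y) (OrderDual.ofDual z), pair_comm]
        exact ⟨lt_of_le_of_ne (not_lt.1 (of_decide_eq_false h.1)) hn.symm, h.2⟩
    rw [hcard] at h
    exact hg c h

/-- The fibre edges containing a given vertex. -/
theorem card_fibreEdge_filter_le {ι : Type*} [Fintype ι] [DecidableEq ι] (w : ι × Bool) :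
    (((univ : Finset (ι × (ι × Bool))).image fun q => fibreEdge q.1 q.2).filter
      fun e => w ∈ e).card ≤ 3 * Fintype.card ι := by
  have hsub : (((univ : Finset (ι × (ι × Bool))).image fun q => fibreEdge q.1 q.2).filter
      fun e => w ∈ e) ⊆ (univ.image fun v => fibreEdge w.1 v) ∪
        (univ.image fun i => fibreEdge i w) := by
    intro e he
    obtain ⟨he, hw⟩ := mem_filter.1 he
    obtain ⟨⟨i, v⟩, -, rfl⟩ := mem_image.1 he
    simp only [fibreEdge, mem_insert, mem_singleton] at hw
    rcases hw with rfl | rfl | rfl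
    · exact mem_union_left _ (mem_image_of_mem _ (mem_univ v))
    · exact mem_union_left _ (mem_image_of_mem _ (mem_univ v))
    · exact mem_union_right _ (mem_image_of_mem (fun i => fibreEdge i w) (mem_univ i))
  calc _ ≤ _ := card_le_card hsub
    _ ≤ _ := card_union_le _ _
    _ ≤ Fintype.card (ι × Bool) + Fintype.card ι := add_le_add card_image_le card_image_le
    _ = 3 * Fintype.card ι := by
      rw [Fintype.card_prod, Fintype.card_bool]
      ring

theorem card_fibreEdge {ι : Type*} [DecidableEq ι] {i : ι} {v : ι × Bool} (h : v.1 ≠ i) :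
    (fibreEdge i v).card = 3 := by
  rw [fibreEdge, card_eq_three]
  refine ⟨_, _, _, by simp, ?_, ?_, rfl⟩ <;>
  · rintro rfl
    exact h rfl

theorem two_pow_two_pow_mul_le {Δ t : ℕ} (ht : 4 ≤ t) (hΔ : Δ < 16 * (t + 1)) :
    (2 : ℝ) ^ ((2 : ℝ) ^ ((1 / 32 : ℝ) * (Δ : ℝ))) * (((4 * t + 1) * 2 : ℕ) : ℝ) ≤
      ((2 ^ 2 ^ t : ℕ) : ℝ) + 1 := by
  obtain ⟨s, rfl⟩ := Nat.exists_eq_add_of_le ht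
  have hs : s + 1 ≤ 2 ^ s := Nat.lt_two_pow_self
  have hexp : (1 / 32 : ℝ) * (Δ : ℝ) ≤ ((s + 3 : ℕ) : ℝ) := by
    have h : (Δ : ℝ) ≤ ((16 * (4 + s + 1) : ℕ) : ℝ) := by exact_mod_cast hΔ.le
    push_cast at h ⊢
    linarith
  have h1 : (2 : ℝ) ^ ((1 / 32 : ℝ) * (Δ : ℝ)) ≤ ((2 ^ (s + 3) : ℕ) : ℝ) := by
    rw [Nat.cast_pow, Nat.cast_ofNat, ← Real.rpow_natCast]
    exact Real.rpow_le_rpow_of_exponent_le one_le_two hexp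
  have h2 : (2 : ℝ) ^ ((2 : ℝ) ^ ((1 / 32 : ℝ) * (Δ : ℝ))) ≤ ((2 ^ 2 ^ (s + 3) : ℕ) : ℝ) := by
    rw [Nat.cast_pow, Nat.cast_ofNat, ← Real.rpow_natCast]
    exact Real.rpow_le_rpow_of_exponent_le one_le_two h1
  have h3 : (4 * (4 + s) + 1) * 2 ≤ 2 ^ 2 ^ (s + 3) :=
    calc (4 * (4 + s) + 1) * 2 ≤ 2 ^ (s + 6) := by
          rw [pow_add]
          omega
      _ ≤ 2 ^ 2 ^ (s + 3) := by
          apply Nat.pow_le_pow_right two_pos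
          rw [pow_add]
          omega
  calc _ ≤ ((2 ^ 2 ^ (s + 3) : ℕ) : ℝ) * ((2 ^ 2 ^ (s + 3) : ℕ) : ℝ) := by
        gcongr
    _ = ((2 ^ 2 ^ (4 + s) : ℕ) : ℝ) := by
        rw [← Nat.cast_mul, ← pow_add]
        congr 2
        ring
    _ ≤ _ := by linarith

/-- There is c > 0 such that for each sufficiently large Δ there is a 3-uniform
hypergraph H with n vertices and maximum degree at most Δ whose 4-colour Ramsey number
satisfies r(H,H,H,H) ≥ 2^{2^{cΔ}}·n. The lower bound r(H,H,H,H) ≥ B is expressed by the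
existence of N with N + 1 ≥ B together with a 4-colouring of the 3-subsets of an N-element
set admitting no monochromatic copy of H. -/
theorem stmt_8 :
    ∃ c : ℝ, 0 < c ∧ ∃ Δ₀ : ℕ, ∀ Δ : ℕ, Δ₀ ≤ Δ →
      ∃ (n : ℕ) (H : Finset (Finset (Fin n))),
        (∀ e ∈ H, e.card = 3) ∧
        (∀ v : Fin n, (H.filter fun e => v ∈ e).card ≤ Δ) ∧
        ∃ N : ℕ,
          (2 : ℝ) ^ ((2 : ℝ) ^ (c * (Δ : ℝ))) * (n : ℝ) ≤ (N : ℝ) + 1 ∧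
          ∃ χ : Finset (Fin N) → Fin 4,
            ¬∃ f : Fin n → Fin N, Function.Injective f ∧
              ∃ i : Fin 4, ∀ e ∈ H, χ (e.image f) = i := by
  refine ⟨1 / 32, by norm_num, 64, fun Δ hΔ => ?_⟩
  obtain ⟨t, ht⟩ : ∃ t, t = Δ / 16 := ⟨_, rfl⟩
  have ht4 : 4 ≤ t := by omega
  obtain ⟨χ, hχ⟩ := exists_coloring_no_mono_fibreEdge t (by omega)
  obtain ⟨φ⟩ : Nonempty (Fin (4 * t + 1) × Bool ≃ Fin ((4 * t + 1) * 2)) :=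
    ⟨Fintype.equivFinOfCardEq (by simp)⟩
  let E : Finset (Finset (Fin (4 * t + 1) × Bool)) :=
    (univ.filter fun q : Fin (4 * t + 1) × (Fin (4 * t + 1) × Bool) => q.2.1 ≠ q.1).image
      fun q => fibreEdge q.1 q.2
  refine ⟨(4 * t + 1) * 2, E.image fun e => e.image φ, ?_, ?_, 2 ^ 2 ^ t,
    two_pow_two_pow_mul_le ht4 (by omega), χ, ?_⟩
  · intro e he
    obtain ⟨e', he', rfl⟩ := mem_image.1 he
    obtain ⟨q, hq, rfl⟩ := mem_image.1 he'
    rw [card_image_of_injective _ φ.injective]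
    exact card_fibreEdge (mem_filter.1 hq).2
  · intro v
    obtain ⟨w, rfl⟩ := φ.surjective v
    rw [filter_image]
    refine card_image_le.trans ((card_le_card ?_).trans
      ((card_fibreEdge_filter_le w).trans ?_))
    · intro e he
      obtain ⟨he, hw⟩ := mem_filter.1 he
      refine mem_filter.2 ⟨image_subset_image (filter_subset _ _) he, ?_⟩
      obtain ⟨w', hw', heq⟩ := mem_image.1 hw
      exact φ.injective heq ▸ hw'
    · rw [Fintype.card_fin]
      omega
  · rintro ⟨f, hf, k, hmono⟩
    refine hχ (f ∘ φ) (hf.comp φ.injective) k fun i v hv => ?_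
    have hE : fibreEdge i v ∈ E :=
      mem_image.2 ⟨(i, v), mem_filter.2 ⟨mem_univ _, hv⟩, rfl⟩
    rw [← image_image]
    exact hmono _ (mem_image.2 ⟨_, hE, rfl⟩)
end

section
/- Let n ≥ 4 be even, let m = ⌈2^{n/4}⌉, and suppose the 2-element subsets of {1,...,m} are coloured red or blue so that no n/2-element subset has all its pairs the same colour. Let T = {0,1}^m, and for ε = (γ_1,...,γ_m) ∈ T set b(ε) = Σ_{i=1}^m γ_i·2^{i-1}; order T by ε < ε' iff b(ε) < b(ε'), and for distinct ε, ε' let δ(ε,ε') be the largest coordinate at which they differ. Colour each triple {ε_1, ε_2, ε_3} of elements of T with ε_1 < ε_2 < ε_3 by one of four colours according to the pair (the red/blue colour of {δ_1, δ_2}, whether δ_1 < δ_2 or δ_1 > δ_2), where δ_1 = δ(ε_1,ε_2) and δ_2 = δ(ε_2,ε_3). Let H be the 3-uniform hypergraph on vertices v_1,...,v_n whose edges are all triples {v_i, v_{i+1}, v_j} for 1 ≤ i, j ≤ n with j ∉ {i, i+1}, where indices are taken cyclically modulo n. Then this 4-colouring of the triples of T contains no monochromatic copy of H. -/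
open Finset

/-- `bval x` is the number whose binary digits are given by `x`; `x < y` in the order on
`{0,1}^m` iff `bval x < bval y`. (Coordinate `i : Fin m` corresponds to γ_{i+1}.) -/
def bval {m : ℕ} (x : Fin m → Bool) : ℕ := ∑ i : Fin m, if x i then 2 ^ (i : ℕ) else 0

/-- `del x y` is the largest coordinate (1-indexed, so a value in {1,...,m}) at which the
distinct sequences `x` and `y` differ. -/
def del {m : ℕ} (x y : Fin m → Bool) : ℕ :=
  (Finset.univ.filter fun i : Fin m => x i ≠ y i).sup fun i => (i : ℕ) + 1

/-- The colour (an element of Bool × Bool) of the triple {x,y,z}, where x < y < z in the order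
given by `bval`: the first component is the red/blue colour of the pair {δ(x,y), δ(y,z)} under
`col`, and the second records whether δ(x,y) < δ(y,z). -/
def triColour {m : ℕ} (col : Finset ℕ → Bool) (x y z : Fin m → Bool) : Bool × Bool :=
  (col {del x y, del y z}, decide (del x y < del y z))

theorem del_le_iff {m : ℕ} (x y : Fin m → Bool) (t : ℕ) :
    del x y ≤ t ↔ ∀ i : Fin m, t ≤ i → x i = y i := by
  simp only [del, Finset.sup_le_iff, Finset.mem_filter, Finset.mem_univ, true_and]
  refine forall_congr' fun i => ?_
  by_cases h : x i = y i <;> simp [h]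

theorem del_comm {m : ℕ} (x y : Fin m → Bool) : del x y = del y x := by
  simp only [del, ne_comm]

theorem del_triangle {m : ℕ} (x y z : Fin m → Bool) :
    del x z ≤ max (del x y) (del y z) := by
  rw [del_le_iff]
  intro i hi
  rw [(del_le_iff x y _).1 le_rfl i (le_trans (le_max_left _ _) hi),
    (del_le_iff y z _).1 le_rfl i (le_trans (le_max_right _ _) hi)]

theorem del_self {m : ℕ} (x : Fin m → Bool) : del x x = 0 := by
  simp [del]

theorem del_pos {m : ℕ} {x y : Fin m → Bool} (h : x ≠ y) : 0 < del x y := by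
  by_contra h0
  exact h (funext fun i => (del_le_iff x y 0).1 (by omega) i (Nat.zero_le _))

theorem exists_del_eq {m : ℕ} {x y : Fin m → Bool} (h : 0 < del x y) :
    ∃ k : Fin m, del x y = k + 1 ∧ x k ≠ y k := by
  by_contra! hc
  have : del x y ≤ del x y - 1 := by
    rw [del_le_iff]
    intro i hi
    rcases Nat.lt_or_ge i (del x y) with h1 | h1
    · exact hc i (by omega)
    · exact (del_le_iff x y _).1 le_rfl i h1
  omega

theorem apply_ne_of_del_eq {m : ℕ} {x y : Fin m → Bool} {k : Fin m}
    (h : del x y = k + 1) : x k ≠ y k := by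
  obtain ⟨l, hl, hne⟩ := exists_del_eq (x := x) (y := y) (by omega)
  rwa [show k = l from Fin.ext (by omega)]

theorem bval_lt {m : ℕ} {x y : Fin m → Bool} {k : Fin m} (h : del x y = k + 1)
    (hx : x k = false) (hy : y k = true) : bval x < bval y := by
  have hle : ∑ i : Fin m, ((if x i then 2 ^ (i : ℕ) else 0) +
      if i = k then 2 ^ (k : ℕ) else 0) ≤
      ∑ i : Fin m, ((if y i then 2 ^ (i : ℕ) else 0) +
        if (i : ℕ) < k then 2 ^ (i : ℕ) else 0) := by
    refine Finset.sum_le_sum fun i _ => ?_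
    rcases lt_trichotomy i k with hi | rfl | hi
    · have hi' : (i : ℕ) < k := hi
      simp only [hi.ne, hi', if_true, if_false]
      split_ifs <;> simp
    · simp [hx, hy]
    · have hi' : (k : ℕ) < i := hi
      have := (del_le_iff x y _).1 h.le i hi'
      simp [this, hi.ne']
  have hlow : ∑ i : Fin m, (if (i : ℕ) < k then 2 ^ (i : ℕ) else 0) < 2 ^ (k : ℕ) := by
    rw [Fin.sum_univ_eq_sum_range (fun i => if i < (k : ℕ) then 2 ^ i else 0),
      ← Finset.sum_filter]
    exact Nat.geomSum_lt le_rfl fun i hi => (Finset.mem_filter.1 hi).2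
  rw [Finset.sum_add_distrib, Finset.sum_add_distrib] at hle
  simp only [Finset.sum_ite_eq', Finset.mem_univ, if_true] at hle
  unfold bval
  omega

/-- If `r` is the point of `{p, q, r}` split off first, the colour of the triple consists of the
colour of the two split levels and of the digit of `r` at the upper one. -/
theorem colour_of_split {m : ℕ} (col : Finset ℕ → Bool) (c : Bool × Bool)
    {p q r : Fin m → Bool} (hpq : p ≠ q) (hlt : del p q < del p r)
    (hc : ∀ x y z : Fin m → Bool, ({x, y, z} : Set (Fin m → Bool)) = {p, q, r} →
      bval x < bval y → bval y < bval z → triColour col x y z = c) :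
    col {del p q, del p r} = c.1 ∧ ∀ k : Fin m, del p r = k + 1 → r k = c.2 := by
  wlog hb : bval p < bval q generalizing p q
  · obtain ⟨l, hl, hne⟩ := exists_del_eq (del_pos hpq)
    have hqp : bval q < bval p := by
      cases hp : p l
      · exact absurd (bval_lt hl hp (by simpa [hp] using hne)) hb
      · exact bval_lt (by rwa [del_comm]) (by simpa [hp] using hne) hp
    have hqr : del q r = del p r := by
      have h1 := del_triangle q p r
      have h2 := del_triangle p q r
      rw [del_comm q p] at h1
      omega
    have := this (p := q) (q := p) hpq.symm (by rwa [hqr, del_comm])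
      (fun x y z h => hc x y z (h.trans (Set.insert_comm _ _ _))) hqp
    rwa [hqr, del_comm q p] at this
  have hqr : del q r = del p r := by
    have h1 := del_triangle q p r
    have h2 := del_triangle p q r
    rw [del_comm q p] at h1
    omega
  obtain ⟨k, hk, hne⟩ := exists_del_eq (x := p) (y := r) (by omega)
  have hqk : p k = q k := (del_le_iff p q k).1 (by omega) k le_rfl
  have huniq : ∀ l : Fin m, del p r = l + 1 → l = k := fun l hl => Fin.ext (by omega)
  cases hr : r k
  · have hp : p k = true := by simpa [hr] using hne
    have := hc r p q (by ext; simp; tauto) (bval_lt (by rwa [del_comm]) hr hp) hb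
    rw [triColour, del_comm r p] at this
    subst this
    refine ⟨by rw [Finset.pair_comm], fun l hl => ?_⟩
    rw [huniq l hl, hr]
    simpa using hlt.le
  · have hp : p k = false := by simpa [hr] using hne
    have := hc p q r rfl hb (bval_lt (hqr.trans hk) (hqk ▸ hp) hr)
    rw [triColour, hqr] at this
    subst this
    refine ⟨rfl, fun l hl => ?_⟩
    rw [huniq l hl, hr]
    simpa using hlt

/-- A family whose triples `{i, s i, j}` are monochromatic yields a set of levels, of size at least
half of the family, all of whose pairs have the same colour. -/
theorem exists_mono_levels {ι : Type*} [Fintype ι] {m : ℕ}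
    (col : Finset ℕ → Bool) (c : Bool × Bool) (s : ι → ι) (hs : Function.Injective s)
    (hsne : ∀ i, s i ≠ i) (f : ι → Fin m → Bool) (hf : Function.Injective f)
    (hc : ∀ i j : ι, j ≠ i → j ≠ s i → ∀ x y z : Fin m → Bool,
      ({x, y, z} : Set (Fin m → Bool)) = {f i, f (s i), f j} →
      bval x < bval y → bval y < bval z → triColour col x y z = c) :
    ∃ W ⊆ Finset.Icc 1 m, Fintype.card ι ≤ 2 * W.card ∧
      ∀ p ⊆ W, p.card = 2 → col p = c.1 := by
  classical
  set d : ι → ℕ := fun i => del (f i) (f (s i)) with hd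
  have hne : ∀ i, f i ≠ f (s i) := fun i h => hsne i (hf h).symm
  have key : ∀ i j, d i < del (f i) (f j) →
      col {d i, del (f i) (f j)} = c.1 ∧
        ∀ k : Fin m, del (f i) (f j) = k + 1 → f j k = c.2 := by
    intro i j hij
    refine colour_of_split col c (hne i) hij (hc i j ?_ ?_)
    · rintro rfl
      simp [del_self] at hij
    · rintro rfl
      exact lt_irrefl _ hij
  have hsep : ∀ i j, del (f i) (f j) ≤ max (d i) (d j) := by
    intro i j
    by_contra! h
    rw [max_lt_iff] at h
    obtain ⟨k, hk, hk'⟩ := exists_del_eq (x := f i) (y := f j) (by omega)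
    have h1 := (key i j h.1).2 k hk
    have h2 := (key j i (by rw [del_comm]; exact h.2)).2 k (by rw [del_comm]; exact hk)
    exact hk' (h2.trans h1.symm)
  have hpair : ∀ i j, d i < d j → col {d i, d j} = c.1 := by
    intro i j hij
    have h1 := hsep i j
    rcases eq_or_ne (del (f i) (f j)) (d j) with h | h
    · rw [← h]
      exact (key i j (by omega)).1
    · have h2 := del_triangle (f i) (f j) (f (s j))
      have h3 := del_triangle (f j) (f i) (f (s j))
      rw [del_comm (f j) (f i)] at h3
      have h4 : del (f i) (f (s j)) = d j := by
        simp only [hd] at *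
        omega
      rw [← h4]
      exact (key i (s j) (by omega)).1
  have hfib : ∀ t ∈ Finset.univ.image d,
      (Finset.univ.filter fun i => d i = t).card ≤ 2 := by
    intro t ht
    obtain ⟨i₀, -, rfl⟩ := Finset.mem_image.1 ht
    obtain ⟨k, hk, -⟩ := exists_del_eq (del_pos (hne i₀))
    have hend : ∀ i, d i = d i₀ → ∃ u v, (u = i ∧ v = s i ∨ u = s i ∧ v = i) ∧
        f u k = c.2 ∧ f v k ≠ c.2 := by
      intro i hi
      have hik := apply_ne_of_del_eq (hi.trans hk)
      by_cases h : f i k = c.2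
      · exact ⟨i, s i, .inl ⟨rfl, rfl⟩, h, fun h' => hik (h.trans h'.symm)⟩
      · refine ⟨s i, i, .inr ⟨rfl, rfl⟩, ?_, h⟩
        revert hik h
        cases f i k <;> cases f (s i) k <;> cases c.2 <;> simp
    have hagree : ∀ i i' u u', d i = d i₀ → d i' = d i₀ → (u = i ∨ u = s i) →
        (u' = i' ∨ u' = s i') → f u k = f u' k → del (f u) (f u') ≤ k := by
      intro i i' u u' hi hi' hu hu' hkk
      have hD : del (f u) (f u') ≤ k + 1 := by
        have h1 : del (f u) (f i) ≤ k + 1 := by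
          rcases hu with rfl | rfl
          · simp [del_self]
          · rw [del_comm]; exact (hi.trans hk).le
        have h2 : del (f i') (f u') ≤ k + 1 := by
          rcases hu' with rfl | rfl
          · simp [del_self]
          · exact (hi'.trans hk).le
        have h3 := hsep i i'
        have h4 := del_triangle (f u) (f i) (f u')
        have h5 := del_triangle (f i) (f i') (f u')
        have h6 : d i₀ = k + 1 := hk
        omega
      by_contra! hlt
      exact apply_ne_of_del_eq (le_antisymm hD hlt) hkk
    obtain ⟨u₀, v₀, huv₀, hu₀, hv₀⟩ := hend i₀ rfl
    have hsub : (Finset.univ.filter fun i => d i = d i₀) ⊆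
        Finset.univ.filter (fun i => i = u₀) ∪ Finset.univ.filter (fun i => s i = u₀) := by
      intro i hi
      replace hi := (Finset.mem_filter.1 hi).2
      obtain ⟨u, v, huv, hu, hv⟩ := hend i hi
      have huu : u = u₀ := by
        by_contra hne'
        have hle := hagree i i₀ u u₀ hi rfl (by tauto) (by tauto) (hu.trans hu₀.symm)
        have huvd : del (f u) (f v) = k + 1 := by
          rcases huv with ⟨rfl, rfl⟩ | ⟨rfl, rfl⟩
          · exact hi.trans hk
          · rw [del_comm]; exact hi.trans hk
        have hu₀v : u₀ ≠ v := by
          rintro rfl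
          exact hv hu₀
        refine hv ((colour_of_split col c (p := f u) (q := f u₀) (r := f v)
          (fun h => hne' (hf h)) (by omega) ?_).2 k huvd)
        intro x y z hxyz
        refine hc i u₀ ?_ ?_ x y z (hxyz.trans ?_)
        · rcases huv with ⟨rfl, rfl⟩ | ⟨rfl, rfl⟩ <;> tauto
        · rcases huv with ⟨rfl, rfl⟩ | ⟨rfl, rfl⟩ <;> tauto
        · rcases huv with ⟨rfl, rfl⟩ | ⟨rfl, rfl⟩ <;> ext <;> simp <;> tauto
      subst huu
      simp only [Finset.mem_union, Finset.mem_filter, Finset.mem_univ, true_and]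
      rcases huv with ⟨rfl, -⟩ | ⟨rfl, -⟩ <;> simp
    refine (Finset.card_le_card hsub).trans ((Finset.card_union_le _ _).trans ?_)
    have h1 : (Finset.univ.filter (fun i => i = u₀)).card ≤ 1 :=
      Finset.card_le_one.2 (by simp)
    have h2 : (Finset.univ.filter (fun i => s i = u₀)).card ≤ 1 :=
      Finset.card_le_one.2 fun a ha b hb => hs
        ((Finset.mem_filter.1 ha).2.trans (Finset.mem_filter.1 hb).2.symm)
    omega
  refine ⟨Finset.univ.image d, ?_, ?_, ?_⟩
  · intro t ht
    obtain ⟨i, -, rfl⟩ := Finset.mem_image.1 ht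
    obtain ⟨k, hk, -⟩ := exists_del_eq (del_pos (hne i))
    have hdk : d i = k + 1 := hk
    rw [Finset.mem_Icc]
    omega
  · exact Finset.card_le_mul_card_image Finset.univ 2 hfib
  · intro p hp hcard
    obtain ⟨a, b, hab, rfl⟩ := Finset.card_eq_two.1 hcard
    obtain ⟨i, -, rfl⟩ := Finset.mem_image.1 (hp (Finset.mem_insert_self a _))
    obtain ⟨j, -, rfl⟩ := Finset.mem_image.1
      (hp (Finset.mem_insert_of_mem (Finset.mem_singleton_self b)))
    rcases lt_or_gt_of_ne hab with h | h
    · exact hpair i j h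
    · rw [Finset.pair_comm]
      exact hpair j i h

/-- Let n ≥ 4 be even, m = ⌈2^{n/4}⌉, and let `col` be a red/blue colouring of
the pairs from {1,...,m} with no monochromatic n/2-element set. Let H be the 3-uniform
hypergraph on v_1,...,v_n (vertex type Fin n, cyclic successor i+1) with edges all triples
{v_i, v_{i+1}, v_j}, j ∉ {i, i+1}. Then the induced 4-colouring `triColour col` of the
triples of T = {0,1}^m contains no monochromatic copy of H. -/
theorem stmt_9 (n m : ℕ) (hn : 4 ≤ n) (hneven : Even n)
    (hm : m = ⌈(2 : ℝ) ^ ((n : ℝ) / 4)⌉₊)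
    (col : Finset ℕ → Bool)
    (hcol : ∀ W ⊆ Finset.Icc 1 m, W.card = n / 2 →
      ¬∃ b : Bool, ∀ p ⊆ W, p.card = 2 → col p = b) :
    ¬∃ f : Fin n → (Fin m → Bool), Function.Injective f ∧
      ∃ c : Bool × Bool, ∀ i j : Fin n, j ≠ i → j ≠ i + ⟨1, by omega⟩ →
        ∀ x y z : Fin m → Bool,
          ({x, y, z} : Set (Fin m → Bool)) = {f i, f (i + ⟨1, by omega⟩), f j} →
          bval x < bval y → bval y < bval z →
          triColour col x y z = c := by
  rintro ⟨f, hf, c, hc⟩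
  have : NeZero n := ⟨by omega⟩
  have hsucc : ∀ i : Fin n, i + ⟨1, by omega⟩ ≠ i := by
    intro i h
    have h0 : (⟨1, by omega⟩ : Fin n) = 0 := add_eq_left.1 h
    simp [Fin.ext_iff] at h0
  obtain ⟨W, hW, hcard, hmono⟩ := exists_mono_levels col c
    (fun i : Fin n => i + ⟨1, by omega⟩) (fun a b h => add_right_cancel h) hsucc f hf hc
  rw [Fintype.card_fin] at hcard
  obtain ⟨W', hW', hcard'⟩ := Finset.exists_subset_card_eq (show n / 2 ≤ W.card by omega)
  exact hcol W' (hW'.trans hW) hcard' ⟨c.1, fun p hp => hmono p (hp.trans hW')⟩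
end

section
/- There is a positive constant c such that for each positive integer m there is a 3-uniform hypergraph H with at most m edges such that the 4-colour Ramsey number of H satisfies r(H,H,H,H) ≥ 2^{2^{c√m}}. -/
open Finset

/-- The counting bound of Erdős: a two-colouring of the pairs of a small set without monochromatic
`k`-subsets. -/
theorem exists_pair_colouring_without_homogeneous (V : Type*) [Fintype V] [DecidableEq V] (k : ℕ)
    (h : 2 * Fintype.card V ^ k < 2 ^ k.choose 2) :
    ∃ ω : Sym2 V → Bool, ∀ (T : Finset V) (b : Bool), T.card = k →
      ¬∀ x ∈ T, ∀ y ∈ T, x ≠ y → ω s(x, y) = b := by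
  classical
  let pairs (T : Finset V) : Finset (Sym2 V) := T.offDiag.image Sym2.mk.uncurry
  let bad (p : Finset V × Bool) : Finset (Sym2 V → Bool) :=
    Fintype.piFinset fun e => if e ∈ pairs p.1 then {p.2} else univ
  have hpairs (T : Finset V) : (pairs T).card = T.card.choose 2 := Sym2.card_image_offDiag T
  have hbad (p : Finset V × Bool) :
      (bad p).card * 2 ^ p.1.card.choose 2 = Fintype.card (Sym2 V → Bool) := by
    have hcard : (bad p).card = 2 ^ ((pairs p.1)ᶜ).card := by
      simp only [bad, Fintype.card_piFinset, apply_ite Finset.card, card_singleton, card_univ,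
        Fintype.card_bool, prod_ite, prod_const, one_pow, one_mul]
      congr 2
      ext e
      simp
    rw [hcard, ← hpairs, ← pow_add, card_compl_add_card]
    simp
  let index := (powersetCard k (univ : Finset V)) ×ˢ (univ : Finset Bool)
  have hunion : (index.biUnion bad).card < Fintype.card (Sym2 V → Bool) := by
    refine lt_of_mul_lt_mul_right ?_ (Nat.zero_le (2 ^ k.choose 2))
    calc (index.biUnion bad).card * 2 ^ k.choose 2
        ≤ (∑ p ∈ index, (bad p).card) * 2 ^ k.choose 2 := by gcongr; exact card_biUnion_le
      _ = ∑ p ∈ index, Fintype.card (Sym2 V → Bool) := by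
          rw [sum_mul]
          refine sum_congr rfl fun p hp => ?_
          rw [← (mem_powersetCard.mp (mem_product.mp hp).1).2, hbad]
      _ = 2 * (Fintype.card V).choose k * Fintype.card (Sym2 V → Bool) := by
          simp [index, card_product, mul_comm]
      _ ≤ 2 * Fintype.card V ^ k * Fintype.card (Sym2 V → Bool) := by
          gcongr; exact Nat.choose_le_pow _ _
      _ < 2 ^ k.choose 2 * Fintype.card (Sym2 V → Bool) := by
          gcongr
      _ = _ := mul_comm _ _
  obtain ⟨ω, hω⟩ : ∃ ω, ω ∉ index.biUnion bad := by
    by_contra! hall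
    rw [eq_univ_iff_forall.mpr hall] at hunion
    exact absurd hunion (by simp)
  refine ⟨ω, fun T b hT hmono => hω (mem_biUnion.mpr ⟨(T, b), ?_, ?_⟩)⟩
  · simp [index, hT]
  · refine Fintype.mem_piFinset.mpr fun e => ?_
    split_ifs with he
    · obtain ⟨⟨x, y⟩, hxy, rfl⟩ := mem_image.mp he
      obtain ⟨hx, hy, hne⟩ := mem_offDiag.mp hxy
      exact mem_singleton.mpr (hmono x hx y hy hne)
    · exact mem_univ _

/-- The highest binary digit in which two distinct natural numbers differ. -/
noncomputable def topDiff (x y : ℕ) : ℕ := sInf {t | x / 2 ^ (t + 1) = y / 2 ^ (t + 1)}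

theorem topDiff_comm (x y : ℕ) : topDiff x y = topDiff y x := by
  simp only [topDiff, eq_comm]

theorem topDiff_le_iff {x y t : ℕ} :
    topDiff x y ≤ t ↔ x / 2 ^ (t + 1) = y / 2 ^ (t + 1) := by
  refine ⟨fun h => ?_, fun h => Nat.sInf_le h⟩
  have hne : {t | x / 2 ^ (t + 1) = y / 2 ^ (t + 1)}.Nonempty := by
    refine ⟨x + y, ?_⟩
    have := Nat.lt_two_pow_self (n := x + y + 1)
    simp only [Set.mem_ofPred_eq]
    rw [Nat.div_eq_of_lt (by omega), Nat.div_eq_of_lt (by omega)]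
  have hmem : x / 2 ^ (topDiff x y + 1) = y / 2 ^ (topDiff x y + 1) := Nat.sInf_mem hne
  obtain ⟨d, rfl⟩ := Nat.exists_eq_add_of_le h
  rw [show topDiff x y + d + 1 = topDiff x y + 1 + d by ring, pow_add, ← Nat.div_div_eq_div_mul,
    ← Nat.div_div_eq_div_mul, hmem]

theorem topDiff_lt {x y n : ℕ} (hn : 0 < n) (hx : x < 2 ^ n) (hy : y < 2 ^ n) :
    topDiff x y < n := by
  obtain ⟨n, rfl⟩ := Nat.exists_eq_succ_of_ne_zero hn.ne'
  exact Nat.lt_succ_of_le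
    (topDiff_le_iff.mpr (by rw [Nat.div_eq_of_lt hx, Nat.div_eq_of_lt hy]))

theorem topDiff_eq_max {x y z : ℕ} (hxy : x < y) (hyz : y < z) :
    topDiff x z = max (topDiff x y) (topDiff y z) := by
  refine eq_of_forall_ge_iff fun t => ?_
  rw [max_le_iff, topDiff_le_iff, topDiff_le_iff, topDiff_le_iff]
  have h₁ := Nat.div_le_div_right (c := 2 ^ (t + 1)) hxy.le
  have h₂ := Nat.div_le_div_right (c := 2 ^ (t + 1)) hyz.le
  omega

theorem div_two_pow_topDiff_ne {x y : ℕ} (hxy : x ≠ y) :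
    x / 2 ^ topDiff x y ≠ y / 2 ^ topDiff x y := by
  intro h
  rcases ht : topDiff x y with _ | t
  · simp [ht] at h; exact hxy h
  · rw [ht, ← topDiff_le_iff] at h
    omega

theorem topDiff_ne {x y z : ℕ} (hxy : x < y) (hyz : y < z) : topDiff x y ≠ topDiff y z := by
  intro h
  have hx := div_two_pow_topDiff_ne hxy.ne
  have hz := div_two_pow_topDiff_ne hyz.ne
  have h₁ := topDiff_le_iff.mp h.le
  have h₂ := topDiff_le_iff.mp h.ge
  have h₃ := topDiff_le_iff.mp (le_refl (topDiff y z))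
  rw [h] at hx h₂
  have h₄ := Nat.div_le_div_right (c := 2 ^ topDiff y z) hxy.le
  have h₅ := Nat.div_le_div_right (c := 2 ^ topDiff y z) hyz.le
  simp only [pow_succ, ← Nat.div_div_eq_div_mul] at h₁ h₃
  omega

/-- An abstraction of the binary branching level of pairs of leaves of an ordered binary tree. -/
structure IsBranching {V W : Type*} [LinearOrder V] [LinearOrder W] (δ : V → V → W) : Prop where
  comm : ∀ x y, δ x y = δ y x
  eq_max : ∀ {x y z}, x < y → y < z → δ x z = max (δ x y) (δ y z)
  ne : ∀ {x y z}, x < y → y < z → δ x y ≠ δ y z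

section SteppingUp

variable {V W : Type*} [LinearOrder V] [LinearOrder W] {δ : V → V → W} {ω : Sym2 W → Bool}

/-- Some consecutive triple of elements of `S` has increasing branching levels. -/
def BranchesUp (δ : V → V → W) (S : Finset V) : Prop :=
  ∃ x ∈ S, ∃ y ∈ S, ∃ z ∈ S, x < y ∧ y < z ∧ δ x y < δ y z

/-- Some increasing triple in `S` has its pair of branching levels coloured `true`. -/
def LevelsTrue (δ : V → V → W) (ω : Sym2 W → Bool) (S : Finset V) : Prop :=
  ∃ x ∈ S, ∃ y ∈ S, ∃ z ∈ S, x < y ∧ y < z ∧ ω s(δ x y, δ y z) = true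

open Classical in
/-- The stepping-up colouring. -/
noncomputable def stepUp (δ : V → V → W) (ω : Sym2 W → Bool) (S : Finset V) : Fin 4 :=
  if BranchesUp δ S then (if LevelsTrue δ ω S then 0 else 1)
  else (if LevelsTrue δ ω S then 2 else 3)

theorem stepUp_eq_iff {S T : Finset V} : stepUp δ ω S = stepUp δ ω T ↔
    (BranchesUp δ S ↔ BranchesUp δ T) ∧ (LevelsTrue δ ω S ↔ LevelsTrue δ ω T) := by
  unfold stepUp
  split_ifs <;> simp_all

theorem exists_increasing_triple_iff (P : V → V → V → Prop) {x y z : V} (hxy : x < y)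
    (hyz : y < z) :
    (∃ x' ∈ ({x, y, z} : Finset V), ∃ y' ∈ ({x, y, z} : Finset V),
      ∃ z' ∈ ({x, y, z} : Finset V), x' < y' ∧ y' < z' ∧ P x' y' z') ↔ P x y z := by
  have hxz := hxy.trans hyz
  simp [hxy, hyz, hxz, hxy.not_gt, hyz.not_gt, hxz.not_gt]

theorem branchesUp_iff {x y z : V} (hxy : x < y) (hyz : y < z) :
    BranchesUp δ {x, y, z} ↔ δ x y < δ y z :=
  exists_increasing_triple_iff (fun x y z => δ x y < δ y z) hxy hyz

theorem levelsTrue_iff {W : Type*} {δ : V → V → W} {ω : Sym2 W → Bool} {x y z : V} (hxy : x < y) (hyz : y < z) :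
    LevelsTrue δ ω {x, y, z} ↔ ω s(δ x y, δ y z) = true :=
  exists_increasing_triple_iff (fun x y z => ω s(δ x y, δ y z) = true) hxy hyz

/-- `a` lies beyond `x` on the side where triples of the given type split off a single vertex. -/
def Beyond (up : Prop) (a x : V) : Prop := (up ∧ x < a) ∨ (¬up ∧ a < x)

theorem IsBranching.of_beyond (hδ : IsBranching δ) {a x y : V} {up : Prop} (hxy : x ≠ y)
    (hup : BranchesUp δ {a, x, y} ↔ up) (hx : Beyond up a x) (hy : Beyond up a y) :
    δ x y < δ a x ∧ δ a x = δ a y ∧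
      (LevelsTrue δ ω {a, x, y} ↔ ω s(δ x y, δ a x) = true) := by
  wlog h : x < y generalizing x y
  · have hyx := lt_of_le_of_ne (not_lt.mp h) hxy.symm
    rw [pair_comm] at hup
    obtain ⟨h₁, h₂, h₃⟩ := this hxy.symm hup hy hx hyx
    rw [pair_comm, hδ.comm x y, ← h₂]
    exact ⟨h₁, rfl, h₃⟩
  rcases hx with ⟨hu, hxa⟩ | ⟨hu, hax⟩
  · have hya : y < a := by rcases hy with h | h; exacts [h.2, absurd hu h.1]
    have hset : ({a, x, y} : Finset V) = {x, y, a} := by rw [insert_comm, pair_comm a y]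
    rw [hset, branchesUp_iff h hya] at hup
    have hlt := hup.mpr hu
    have hmax := hδ.eq_max h hya
    rw [max_eq_right hlt.le] at hmax
    rw [hset, levelsTrue_iff h hya, hδ.comm a x, hδ.comm a y, hmax]
    exact ⟨hlt, rfl, Iff.rfl⟩
  · rw [branchesUp_iff hax h] at hup
    have hlt : δ x y < δ a x :=
      lt_of_le_of_ne (not_lt.mp (fun h => hu (hup.mp h))) (hδ.ne hax h).symm
    have hmax := hδ.eq_max hax h
    rw [max_eq_left hlt.le] at hmax
    rw [levelsTrue_iff hax h, hmax, Sym2.eq_swap]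
    exact ⟨hlt, rfl, Iff.rfl⟩

theorem IsBranching.pair_levels_of_beyond (hδ : IsBranching δ) {a b c d : V} {up col : Prop}
    (hbc : b ≠ c) (hcd : c ≠ d)
    (hb : Beyond up a b) (hc : Beyond up a c) (hd : Beyond up a d)
    (h₁ : BranchesUp δ {a, b, c} ↔ up) (h₂ : BranchesUp δ {a, c, d} ↔ up)
    (h₃ : LevelsTrue δ ω {a, c, d} ↔ col) :
    δ a b ≠ δ c d ∧ (ω s(δ a b, δ c d) = true ↔ col) := by
  obtain ⟨-, hab, -⟩ := hδ.of_beyond (ω := ω) hbc h₁ hb hc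
  obtain ⟨hlt, -, hcol⟩ := hδ.of_beyond (ω := ω) hcd h₂ hc hd
  rw [hab, ← h₃, hcol, Sym2.eq_swap]
  exact ⟨hlt.ne', Iff.rfl⟩

theorem exists_beyond (up : Prop) (S : Finset V) (hS : S.Nonempty) :
    ∃ a ∈ S, ∀ x ∈ S, a ≠ x → Beyond up a x := by
  by_cases h : up
  · exact ⟨S.max' hS, S.max'_mem hS, fun x hx hne =>
      Or.inl ⟨h, lt_of_le_of_ne (S.le_max' x hx) hne.symm⟩⟩
  · exact ⟨S.min' hS, S.min'_mem hS, fun x hx hne =>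
      Or.inr ⟨h, lt_of_le_of_ne (S.min'_le x hx) hne⟩⟩

/-- If all four triples of two disjoint pairs have the same stepped-up colour, the levels of the
two pairs are distinct and their colour is determined. -/
theorem IsBranching.pair_levels (hδ : IsBranching δ) {a b c d : V} {up col : Prop}
    (hab : a ≠ b) (hac : a ≠ c) (had : a ≠ d) (hbc : b ≠ c) (hbd : b ≠ d) (hcd : c ≠ d)
    (habc : (BranchesUp δ {a, b, c} ↔ up) ∧ (LevelsTrue δ ω {a, b, c} ↔ col))
    (habd : (BranchesUp δ {a, b, d} ↔ up) ∧ (LevelsTrue δ ω {a, b, d} ↔ col))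
    (hcda : (BranchesUp δ {c, d, a} ↔ up) ∧ (LevelsTrue δ ω {c, d, a} ↔ col))
    (hcdb : (BranchesUp δ {c, d, b} ↔ up) ∧ (LevelsTrue δ ω {c, d, b} ↔ col)) :
    δ a b ≠ δ c d ∧ (ω s(δ a b, δ c d) = true ↔ col) := by
  have rot (x y z : V) : ({x, y, z} : Finset V) = {z, x, y} := by
    rw [pair_comm y z, insert_comm]
  have swap (x y z : V) : ({x, y, z} : Finset V) = {y, x, z} := insert_comm x y _
  obtain ⟨w, hw, hext⟩ := exists_beyond up ({a, b, c, d} : Finset V) (by simp)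
  simp only [mem_insert, mem_singleton, forall_eq_or_imp, forall_eq] at hw hext
  obtain ⟨ha, hb, hc, hd⟩ := hext
  rcases hw with rfl | rfl | rfl | rfl
  · rw [rot c] at hcda
    exact hδ.pair_levels_of_beyond hbc hcd (hb hab) (hc hac) (hd had) habc.1 hcda.1 hcda.2
  · rw [rot c] at hcdb
    rw [swap a] at habc
    rw [hδ.comm]
    exact hδ.pair_levels_of_beyond hac hcd (ha hab.symm) (hc hbc) (hd hbd) habc.1 hcdb.1 hcdb.2
  · rw [rot a] at habc
    rw [ne_comm, Sym2.eq_swap]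
    exact hδ.pair_levels_of_beyond had.symm hab (hd hcd) (ha hac.symm) (hb hbc.symm)
      hcda.1 habc.1 habc.2
  · rw [rot a] at habd
    rw [swap c] at hcda
    rw [ne_comm, Sym2.eq_swap, hδ.comm c]
    exact hδ.pair_levels_of_beyond hac.symm hab (hc hcd.symm) (ha had.symm) (hb hbd.symm)
      hcda.1 habd.1 habd.2

/-- A colouring of pairs of levels with no monochromatic `k`-set steps up to a four-colouring of
triples in which no `k` disjoint pairs have all triples inside the union of two of the pairs of
the same colour. -/
theorem IsBranching.no_monochromatic_pairs (hδ : IsBranching δ) {k : ℕ}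
    (hω : ∀ (T : Finset W) (b : Bool), T.card = k →
      ¬∀ x ∈ T, ∀ y ∈ T, x ≠ y → ω s(x, y) = b)
    (g : Fin k × Bool → V) (hg : Function.Injective g) (i : Fin 4)
    (hmono : ∀ j x, x.1 ≠ j → stepUp δ ω {g (j, false), g (j, true), g x} = i) : False := by
  classical
  by_cases hk : ∃ j l : Fin k, l ≠ j
  swap
  · push Not at hk
    let T : Finset W := univ.image fun j => δ (g (j, false)) (g (j, true))
    have hT : T.card = k := by
      rw [card_image_of_injective _ fun j l _ => hk l j, card_univ, Fintype.card_fin]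
    refine hω T true hT fun x hx y hy hne => ?_
    obtain ⟨j, -, rfl⟩ := mem_image.mp hx
    obtain ⟨l, -, rfl⟩ := mem_image.mp hy
    exact absurd (by rw [hk j l]) hne
  obtain ⟨j₀, l₀, h₀⟩ := hk
  set S₀ : Finset V := {g (j₀, false), g (j₀, true), g (l₀, false)}
  have hcol (j x) (h : x.1 ≠ j) :
      (BranchesUp δ {g (j, false), g (j, true), g x} ↔ BranchesUp δ S₀) ∧
      (LevelsTrue δ ω {g (j, false), g (j, true), g x} ↔ LevelsTrue δ ω S₀) :=
    stepUp_eq_iff.mp ((hmono j x h).trans (hmono j₀ (l₀, false) h₀).symm)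
  have hpair (j l : Fin k) (h : j ≠ l) :=
    hδ.pair_levels (ω := ω) (hg.ne (by simp)) (hg.ne (by simp [h])) (hg.ne (by simp [h]))
      (hg.ne (by simp [h])) (hg.ne (by simp [h])) (hg.ne (by simp))
      (hcol j (l, false) h.symm) (hcol j (l, true) h.symm)
      (hcol l (j, false) h) (hcol l (j, true) h)
  let level (j : Fin k) : W := δ (g (j, false)) (g (j, true))
  have hinj : Function.Injective level := fun j l h => by
    by_contra hne
    exact (hpair j l hne).1 h
  refine hω (univ.image level) (decide (LevelsTrue δ ω S₀)) ?_ fun x hx y hy hne => ?_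
  · rw [card_image_of_injective _ hinj, card_univ, Fintype.card_fin]
  · obtain ⟨j, -, rfl⟩ := mem_image.mp hx
    obtain ⟨l, -, rfl⟩ := mem_image.mp hy
    have := (hpair j l fun h => hne (by rw [h])).2
    rw [Bool.eq_iff_iff, decide_eq_true_iff]
    exact this

end SteppingUp

theorem isBranching_topDiff {n : ℕ} (hn : 0 < n) :
    IsBranching fun x y : Fin (2 ^ n) => (⟨topDiff x y, topDiff_lt hn x.2 y.2⟩ : Fin n) where
  comm x y := Fin.ext (topDiff_comm x y)
  eq_max {x y z} hxy hyz := Fin.ext (by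
    have := topDiff_eq_max (Fin.lt_def.mp hxy) (Fin.lt_def.mp hyz)
    simpa using this)
  ne hxy hyz h := topDiff_ne (Fin.lt_def.mp hxy) (Fin.lt_def.mp hyz) (congrArg Fin.val h)

theorem exists_hypergraph_four_colouring {s : ℕ} (hs : 0 < s) :
    ∃ (n : ℕ) (H : Finset (Finset (Fin n))),
      (∀ e ∈ H, e.card = 3) ∧ H.card ≤ 32 * s ^ 2 ∧
      ∃ χ : Finset (Fin (2 ^ 2 ^ s)) → Fin 4,
        ¬∃ f : Fin n → Fin (2 ^ 2 ^ s), Function.Injective f ∧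
          ∃ i : Fin 4, ∀ e ∈ H, χ (e.image f) = i := by
  classical
  let v := Fintype.equivFin (Fin (4 * s) × Bool)
  let edge (p : Fin (4 * s) × Fin (4 * s) × Bool) : Finset (Fin _) :=
    {v (p.1, false), v (p.1, true), v p.2}
  obtain ⟨ω, hω⟩ := exists_pair_colouring_without_homogeneous (Fin (2 ^ s)) (4 * s) (by
    rw [Fintype.card_fin, ← pow_mul, ← pow_succ']
    refine Nat.pow_lt_pow_right (by norm_num) ?_
    rw [Nat.choose_two_right, Nat.lt_iff_add_one_le, Nat.le_div_iff_mul_le two_pos]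
    obtain ⟨t, rfl⟩ := Nat.exists_eq_succ_of_ne_zero hs.ne'
    rw [show 4 * t.succ - 1 = 4 * t + 3 by omega, Nat.succ_eq_add_one]
    nlinarith)
  refine ⟨_, (univ.filter fun p => p.2.1 ≠ p.1).image edge, ?_, ?_,
    stepUp (fun x y => ⟨topDiff x y, topDiff_lt (Nat.two_pow_pos s) x.2 y.2⟩) ω, ?_⟩
  · intro e he
    obtain ⟨⟨j, x⟩, hx, rfl⟩ := mem_image.mp he
    have hx : x.1 ≠ j := (mem_filter.mp hx).2
    refine card_eq_three.mpr ⟨_, _, _, v.injective.ne ?_, v.injective.ne ?_, v.injective.ne ?_, rfl⟩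
    · simp
    · rintro h; exact hx (congrArg Prod.fst h).symm
    · rintro h; exact hx (congrArg Prod.fst h).symm
  · calc _ ≤ _ := card_image_le
      _ ≤ _ := card_filter_le _ _
      _ = 32 * s ^ 2 := by simp; ring
  · rintro ⟨f, hf, i, hmono⟩
    refine (isBranching_topDiff (Nat.two_pow_pos s)).no_monochromatic_pairs hω (f ∘ v)
      (hf.comp v.injective) i fun j x hx => ?_
    have := hmono (edge (j, x)) (mem_image_of_mem _ (by simpa using hx))
    simpa [edge, image_insert] using this

/-- There is c > 0 such that for each positive integer m there is a 3-uniform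
hypergraph H with at most m edges whose 4-colour Ramsey number satisfies
r(H,H,H,H) ≥ 2^{2^{c√m}}. The lower bound r(H,H,H,H) ≥ B is expressed by the existence of N
with N + 1 ≥ B together with a 4-colouring of the 3-subsets of an N-element set admitting no
monochromatic copy of H. -/
theorem stmt_10 :
    ∃ c : ℝ, 0 < c ∧ ∀ m : ℕ, 0 < m →
      ∃ (n : ℕ) (H : Finset (Finset (Fin n))),
        (∀ e ∈ H, e.card = 3) ∧
        H.card ≤ m ∧
        ∃ N : ℕ,
          (2 : ℝ) ^ ((2 : ℝ) ^ (c * Real.sqrt m)) ≤ (N : ℝ) + 1 ∧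
          ∃ χ : Finset (Fin N) → Fin 4,
            ¬∃ f : Fin n → Fin N, Function.Injective f ∧
              ∃ i : Fin 4, ∀ e ∈ H, χ (e.image f) = i := by
  refine ⟨1 / 12, by norm_num, fun m _ => ?_⟩
  have key (s : ℕ) (h : m ≤ 144 * s ^ 2) :
      (2 : ℝ) ^ ((2 : ℝ) ^ (1 / 12 * Real.sqrt m)) ≤ (2 : ℝ) ^ 2 ^ s := by
    have hsqrt : Real.sqrt m ≤ 12 * s :=
      Real.sqrt_le_iff.mpr ⟨by positivity, by rw [mul_pow]; norm_num; exact_mod_cast h⟩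
    have hexp : (2 : ℝ) ^ (1 / 12 * Real.sqrt m) ≤ ((2 ^ s : ℕ) : ℝ) := by
      rw [Nat.cast_pow, ← Real.rpow_natCast]
      exact Real.rpow_le_rpow_of_exponent_le (by norm_num) (by linarith)
    rw [← Real.rpow_natCast]
    exact Real.rpow_le_rpow_of_exponent_le (by norm_num) hexp
  rcases lt_or_ge m 32 with hm | hm
  · refine ⟨4, ∅, by simp, by simp, 3, ?_, fun _ => 0, ?_⟩
    · refine (key 1 (by omega)).trans (by norm_num)
    · rintro ⟨f, hf, -⟩
      simpa using Fintype.card_le_of_injective f hf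
  · have hs : 0 < Nat.sqrt (m / 32) := Nat.sqrt_pos.mpr (by omega)
    have hle := Nat.sqrt_le' (m / 32)
    have hlt := Nat.lt_succ_sqrt' (m / 32)
    set s := Nat.sqrt (m / 32)
    obtain ⟨n, H, hH, hcard, χ, hχ⟩ := exists_hypergraph_four_colouring hs
    refine ⟨n, H, hH, by omega, 2 ^ 2 ^ s, ?_, χ, hχ⟩
    have hm' : m ≤ 144 * s ^ 2 := by
      rw [Nat.succ_eq_add_one] at hlt
      have : m < 32 * (s + 1) ^ 2 := by omega
      nlinarith
    refine (key s hm').trans ?_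
    push_cast
    linarith
end

section
/- For all integers k ≥ 3 and q ≥ 2 there is a constant c depending only on k and q such that the q-colour Ramsey number of any k-uniform hypergraph H with m ≥ 2 edges satisfies r(H,...,H) ≤ t_k(c·√m) for k ≥ 4, and r(H,...,H) ≤ t_3(c·√m·log m) for k = 3. -/
open Finset

/-- The tower function: `tower 0 x = x` and `tower (i+1) x = 2 ^ tower i x`, so that the
function t_i of the paper (t_1(x) = x, t_{i+1}(x) = 2^{t_i(x)}) is `tower (i-1)`. -/
noncomputable def tower : ℕ → ℝ → ℝ
  | 0, x => x
  | i + 1, x => (2 : ℝ) ^ tower i x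

/-- An end-homogeneous set `A` extends to one with `s` further elements, taken from a sufficiently
large set `B` lying above `A`. Here end-homogeneous means that the
colour of a `(j+2)`-set depends only on its `j+1` smallest elements. -/
theorem exists_endHomogeneous {q : ℕ} (j r : ℕ) (χ : Finset ℕ → Fin q) (s : ℕ) :
    ∀ A B : Finset ℕ, (∀ a ∈ A, ∀ b ∈ B, a < b) →
      (∀ e ⊆ A, e.card = j + 1 → ∀ x ∈ A ∪ B, ∀ y ∈ A ∪ B, (∀ z ∈ e, z < x) → (∀ z ∈ e, z < y) →
        χ (insert x e) = χ (insert y e)) →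
      A.card + s ≤ r → (q ^ r ^ j + 1) ^ s ≤ B.card →
      ∃ A' : Finset ℕ, A ⊆ A' ∧ A' ⊆ A ∪ B ∧ A'.card = A.card + s ∧
        ∀ e ⊆ A', e.card = j + 1 → ∀ x ∈ A', ∀ y ∈ A', (∀ z ∈ e, z < x) → (∀ z ∈ e, z < y) →
          χ (insert x e) = χ (insert y e) := by
  induction s with
  | zero =>
    intro A B _ h _ _
    exact ⟨A, Subset.rfl, subset_union_left, rfl, fun e he hc x hx y hy =>
      h e he hc x (mem_union_left _ hx) y (mem_union_left _ hy)⟩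
  | succ s ih =>
    intro A B hAB h hr hB
    have hBne : B.Nonempty := by
      rw [← card_pos]
      exact lt_of_lt_of_le (by positivity) hB
    set a := B.min' hBne with ha
    have haB : a ∈ B := B.min'_mem hBne
    have haA : a ∉ A := fun h' => lt_irrefl _ (hAB a h' a haB)
    let pat : ℕ → (A.powersetCard j → Fin q) := fun b e => χ (insert b (insert a e.1))
    have hpat : Fintype.card (A.powersetCard j → Fin q) ≤ q ^ r ^ j := by
      have hq : 0 < q := (Nat.zero_le _).trans_lt (χ ∅).isLt
      rw [Fintype.card_fun, Fintype.card_fin, Fintype.card_coe, card_powersetCard]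
      refine Nat.pow_le_pow_right hq ((Nat.choose_le_pow _ _).trans ?_)
      exact Nat.pow_le_pow_left (by omega) _
    have hB1 : Fintype.card (A.powersetCard j → Fin q) * (q ^ r ^ j + 1) ^ s
        ≤ (B.erase a).card := by
      rw [card_erase_of_mem haB]
      have h1 := Nat.mul_le_mul_right ((q ^ r ^ j + 1) ^ s) hpat
      have h2 : 1 ≤ (q ^ r ^ j + 1) ^ s := Nat.one_le_pow _ _ (by omega)
      rw [pow_succ, mul_add, mul_one, mul_comm] at hB
      omega
    obtain ⟨ψ, -, hψ⟩ := exists_le_card_fiber_of_mul_le_card_of_maps_to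
      (s := B.erase a) (t := (univ : Finset (A.powersetCard j → Fin q))) (f := pat)
      (fun _ _ => mem_univ _) ⟨pat 0, mem_univ _⟩ (by rw [card_univ]; exact hB1)
    set B' := (B.erase a).filter (fun b => pat b = ψ) with hB'
    have hlt : ∀ b ∈ B', a < b := fun b hb => by
      have hb' := mem_of_mem_filter b hb
      exact lt_of_le_of_ne (B.min'_le b (mem_of_mem_erase hb')) (ne_of_mem_erase hb').symm
    have hB'B : B' ⊆ B := (filter_subset _ _).trans (erase_subset _ _)
    have hA' := ih (insert a A) B' ?_ ?_ ?_ hψ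
    · obtain ⟨A', h1, h2, h3, h4⟩ := hA'
      refine ⟨A', (subset_insert _ _).trans h1, h2.trans ?_, ?_, h4⟩
      · refine union_subset (insert_subset (mem_union_right _ haB) subset_union_left)
          (hB'B.trans subset_union_right)
      · rw [h3, card_insert_of_notMem haA]; ring
    · intro x hx b hb
      rcases mem_insert.1 hx with rfl | hx
      · exact hlt b hb
      · exact hAB x hx b (hB'B hb)
    · intro e he hc x hx y hy hex hey
      have hsub : ∀ x ∈ insert a A ∪ B', x ∈ A ∪ B := by
        intro x hx
        simp only [mem_union, mem_insert] at hx ⊢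
        rcases hx with (rfl | hx) | hx
        · exact Or.inr haB
        · exact Or.inl hx
        · exact Or.inr (hB'B hx)
      by_cases hae : a ∈ e
      · have hin : ∀ x ∈ insert a A ∪ B', (∀ z ∈ e, z < x) → x ∈ B' := by
          intro x hx hex
          have := hex a hae
          simp only [mem_union, mem_insert] at hx
          rcases hx with (rfl | hx) | hx
          · exact absurd this (lt_irrefl _)
          · exact absurd (this.trans (hAB x hx a haB)) (lt_irrefl _)
          · exact hx
        have hmem : e.erase a ∈ A.powersetCard j := by
          rw [mem_powersetCard, card_erase_of_mem hae, hc]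
          exact ⟨subset_insert_iff.1 he, rfl⟩
        have hx' := congrFun (mem_filter.1 (hin x hx hex)).2 ⟨_, hmem⟩
        have hy' := congrFun (mem_filter.1 (hin y hy hey)).2 ⟨_, hmem⟩
        have := hx'.trans hy'.symm
        simpa only [pat, insert_erase hae] using this
      · exact h e ((subset_insert_iff_of_notMem hae).1 he) hc x (hsub x hx) y (hsub y hy) hex hey
    · rw [card_insert_of_notMem haA]; omega

/-- The binary logarithm of the Erdős–Rado bound for the `q`-colour Ramsey number of the complete
`(j+2)`-uniform hypergraph on `l` vertices. -/
def ramseyExp (q l : ℕ) : ℕ → ℕ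
  | 0 => q * (q * l + 1)
  | j + 1 => q * (2 ^ ramseyExp q l j + 1) ^ (j + 2)

/-- The stepping-down argument of Erdős and Rado. -/
theorem ramsey_step {q : ℕ} (j r l : ℕ)
    (ih : ∀ (χ : Finset ℕ → Fin q) (B : Finset ℕ), r ≤ B.card →
      ∃ S ⊆ B, S.card = l ∧ ∃ i, ∀ e ⊆ S, e.card = j + 1 → χ e = i)
    (χ : Finset ℕ → Fin q) (B : Finset ℕ) (hB : 2 ^ (q * (r + 1) ^ (j + 1)) ≤ B.card) :
    ∃ S ⊆ B, S.card = l ∧ ∃ i, ∀ e ⊆ S, e.card = j + 2 → χ e = i := by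
  have hq : 0 < q := (Nat.zero_le _).trans_lt (χ ∅).isLt
  have hW : (q ^ (r + 1) ^ j + 1) ^ (r + 1) ≤ B.card := by
    refine le_trans ?_ hB
    have h1 : q ^ (r + 1) ^ j + 1 ≤ (q + 1) ^ (r + 1) ^ j :=
      Nat.pow_lt_pow_left (Nat.lt_succ_self q) (by positivity)
    have h2 : q + 1 ≤ 2 ^ q := Nat.lt_two_pow_self
    calc (q ^ (r + 1) ^ j + 1) ^ (r + 1) ≤ ((2 ^ q) ^ (r + 1) ^ j) ^ (r + 1) :=
          Nat.pow_le_pow_left (h1.trans (Nat.pow_le_pow_left h2 _)) _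
      _ = 2 ^ (q * (r + 1) ^ (j + 1)) := by rw [← pow_mul, ← pow_mul, pow_succ]
  obtain ⟨A, -, hAB, hA, hE⟩ := exists_endHomogeneous j (r + 1) χ (r + 1) ∅ B (by simp)
    (by
      intro e he hc
      rw [subset_empty.1 he] at hc
      simp at hc) (by simp) hW
  simp only [empty_union, card_empty, zero_add] at hAB hA
  have hAne : A.Nonempty := card_pos.1 (by omega)
  set t := A.max' hAne
  have htA : t ∈ A := A.max'_mem hAne
  obtain ⟨S, hS, hl, i, hi⟩ := ih (fun e => χ (insert t e)) (A.erase t)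
    (by rw [card_erase_of_mem htA]; omega)
  have hSA : S ⊆ A := hS.trans (erase_subset _ _)
  refine ⟨S, hSA.trans hAB, hl, i, fun g hg hc => ?_⟩
  have hgne : g.Nonempty := card_pos.1 (by omega)
  set x := g.max' hgne
  have hxg : x ∈ g := g.max'_mem hgne
  have hsub : g.erase x ⊆ S := (erase_subset _ _).trans hg
  have hcard : (g.erase x).card = j + 1 := by rw [card_erase_of_mem hxg]; omega
  rw [← hi _ hsub hcard]
  nth_rewrite 1 [← insert_erase hxg]
  refine hE _ (hsub.trans hSA) hcard _ (hSA (hg hxg)) _ htA ?_ ?_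
  · intro z hz
    exact lt_of_le_of_ne (g.le_max' z (mem_of_mem_erase hz)) (ne_of_mem_erase hz)
  · intro z hz
    have hz' := hS (hsub hz)
    exact lt_of_le_of_ne (A.le_max' z (mem_of_mem_erase hz')) (ne_of_mem_erase hz')

/-- The Erdős–Rado upper bound for multicolour Ramsey numbers of complete uniform hypergraphs. -/
theorem exists_monochromatic_clique {q : ℕ} (l j : ℕ) :
    ∀ (χ : Finset ℕ → Fin q) (B : Finset ℕ), 2 ^ ramseyExp q l j ≤ B.card →
      ∃ S ⊆ B, S.card = l ∧ ∃ i, ∀ e ⊆ S, e.card = j + 2 → χ e = i := by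
  induction j with
  | zero =>
    intro χ B hB
    refine ramsey_step 0 (q * l) l (fun χ B hB => ?_) χ B (by simpa [ramseyExp] using hB)
    obtain ⟨i, -, hi⟩ := exists_le_card_fiber_of_mul_le_card_of_maps_to
      (s := B) (t := (univ : Finset (Fin q))) (f := fun b => χ {b}) (n := l)
      (fun _ _ => mem_univ _) ⟨χ ∅, mem_univ _⟩ (by simpa using hB)
    obtain ⟨S, hS, hl⟩ := exists_subset_card_eq hi
    refine ⟨S, hS.trans (filter_subset _ _), hl, i, fun e he hc => ?_⟩
    obtain ⟨x, rfl⟩ := card_eq_one.1 hc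
    exact (mem_filter.1 (hS (he (mem_singleton_self x)))).2
  | succ j ih => exact fun χ B hB => ramsey_step (j + 1) _ l ih χ B hB

/-- Erdős' box theorem: a dense `l`-partite `l`-uniform hypergraph contains a complete
`l`-partite one with parts of size `n`. -/
theorem exists_box {n M : ℕ} (hn : 1 ≤ n) (l : ℕ) :
    ∀ p : ℕ, 1 ≤ p → n * 2 ^ ((2 * n) ^ l * p) ≤ M → ∀ E : Finset (Fin l → Fin M),
      M ^ l ≤ 2 ^ p * E.card →
      ∃ T : Fin l → (Fin n ↪ Fin M), ∀ c : Fin l → Fin n, (fun i => T i (c i)) ∈ E := by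
  induction l with
  | zero =>
    intro p _ _ E hE
    have hne : E.Nonempty := by
      rw [nonempty_iff_ne_empty]
      rintro rfl
      simp at hE
    obtain ⟨x, hx⟩ := hne
    refine ⟨fun i => i.elim0, fun c => ?_⟩
    rwa [Subsingleton.elim (fun i : Fin 0 => _) x]
  | succ l ih =>
    intro p hp hM E hE
    have hexp : p + 1 ≤ (2 * n) ^ (l + 1) * p := by
      have : 2 ≤ (2 * n) ^ (l + 1) :=
        le_trans (by omega) (Nat.le_self_pow (by omega) (2 * n))
      nlinarith
    have hM' : n * 2 ^ (p + 1) ≤ M :=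
      le_trans (Nat.mul_le_mul_left _ (Nat.pow_le_pow_right (by omega) hexp)) hM
    have hM0 : 0 < M := lt_of_lt_of_le (by positivity) hM'
    let N : (Fin l → Fin M) → Finset (Fin M) := fun y => univ.filter fun x => Fin.cons x y ∈ E
    have hsum : E.card = ∑ y, (N y).card := by
      have h1 : E.card = ((univ : Finset (Fin M × (Fin l → Fin M))).filter
          fun z => Fin.cons z.1 z.2 ∈ E).card := by
        refine card_bij' (fun f _ => (f 0, Fin.tail f)) (fun z _ => Fin.cons z.1 z.2)
          ?_ ?_ ?_ ?_
        · intro f hf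
          simpa using hf
        · intro z hz
          exact (mem_filter.1 hz).2
        · intro f _
          simp
        · intro z _
          simp
      rw [h1, card_filter, Fintype.sum_prod_type_right]
      exact sum_congr rfl fun y _ => (card_filter _ _).symm
    have hYcard : (univ : Finset (Fin l → Fin M)).card = M ^ l := by simp
    let G : (Fin n ↪ Fin M) → Finset (Fin l → Fin M) := fun t =>
      univ.filter fun y => ∀ j, Fin.cons (t j) y ∈ E
    have hdouble : ∑ t, (G t).card = ∑ y, (N y).card.descFactorial n := by
      simp only [G, card_filter]
      rw [sum_comm]
      refine sum_congr rfl fun y _ => ?_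
      rw [← card_filter]
      have h2 : (N y).card.descFactorial n = Fintype.card (Fin n ↪ N y) := by
        simp [Fintype.card_embedding_eq]
      rw [h2, ← Fintype.card_subtype]
      refine Fintype.card_congr ⟨fun t => ⟨fun j => ⟨t.1 j, by simpa [N] using t.2 j⟩, ?_⟩,
        fun t => ⟨t.trans (Function.Embedding.subtype _), ?_⟩, ?_, ?_⟩
      · intro a b hab
        exact t.1.injective (Subtype.ext_iff.1 hab)
      · intro j
        exact (mem_filter.1 (t j).2).2
      · intro t
        ext
        rfl
      · intro t
        ext
        rfl
    have hpm : M ^ n * M ^ l ≤ 2 ^ (n * (p + 1)) * ∑ t, (G t).card := by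
      have h1 : ∑ y, ((N y).card + 1 - n) ^ n ≤ ∑ t, (G t).card := by
        rw [hdouble]
        exact sum_le_sum fun y _ => Nat.pow_sub_le_descFactorial _ _
      set a : (Fin l → Fin M) → ℕ := fun y => (N y).card + 1 - n
      have h2 : M * M ^ l ≤ 2 ^ (p + 1) * ∑ y, a y := by
        have h3 : E.card ≤ ∑ y, a y + M ^ l * n := by
          rw [hsum, ← hYcard, ← smul_eq_mul, ← sum_const, ← sum_add_distrib]
          exact sum_le_sum fun y _ => by simp only [a]; omega
        have h4 := Nat.mul_le_mul_left (2 ^ (p + 1)) h3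
        have h5 := Nat.mul_le_mul_right (M ^ l) hM'
        rw [pow_succ] at hE
        have h6 : 2 ^ (p + 1) = 2 * 2 ^ p := by ring
        nlinarith
      have h3 : (∑ y, a y) ^ n ≤ (M ^ l) ^ (n - 1) * ∑ y, a y ^ n := by
        obtain ⟨n, rfl⟩ : ∃ n', n = n' + 1 := ⟨n - 1, by omega⟩
        rw [← hYcard]
        exact pow_sum_le_card_mul_sum_pow (fun _ _ => Nat.zero_le _) n
      have h4 : (M * M ^ l) ^ n ≤ (2 ^ (p + 1)) ^ n * ((M ^ l) ^ (n - 1) * ∑ y, a y ^ n) :=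
        (Nat.pow_le_pow_left h2 n).trans (by
          rw [mul_pow]
          exact Nat.mul_le_mul_left _ h3)
      have h5 : (M ^ l) ^ (n - 1) * (M ^ n * M ^ l)
          ≤ (M ^ l) ^ (n - 1) * (2 ^ (n * (p + 1)) * ∑ y, a y ^ n) := by
        calc (M ^ l) ^ (n - 1) * (M ^ n * M ^ l) = (M * M ^ l) ^ n := by
              rw [mul_pow, mul_left_comm, pow_sub_one_mul (by omega)]
          _ ≤ _ := h4
          _ = _ := by rw [mul_comm n, pow_mul]; ring
      exact (Nat.le_of_mul_le_mul_left h5 (by positivity)).trans (Nat.mul_le_mul_left _ h1)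
    obtain ⟨t, ht⟩ : ∃ t, M ^ l ≤ 2 ^ (n * (p + 1)) * (G t).card := by
      by_contra! hcon
      have hne : Nonempty (Fin n ↪ Fin M) := by
        refine Function.Embedding.nonempty_of_card_le ?_
        simp only [Fintype.card_fin]
        exact le_trans (Nat.le_mul_of_pos_right _ (by positivity)) hM'
      have h1 : 2 ^ (n * (p + 1)) * ∑ t, (G t).card < ∑ _t : Fin n ↪ Fin M, M ^ l := by
        rw [mul_sum]
        exact sum_lt_sum_of_nonempty univ_nonempty fun t _ => hcon t
      rw [sum_const, smul_eq_mul, card_univ, Fintype.card_embedding_eq, Fintype.card_fin,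
        Fintype.card_fin] at h1
      have h2 := Nat.mul_le_mul_right (M ^ l) (Nat.descFactorial_le_pow M n)
      omega
    obtain ⟨T, hT⟩ := ih (n * (p + 1)) (by nlinarith) (by
      refine le_trans (Nat.mul_le_mul_left _ (Nat.pow_le_pow_right (by omega) ?_)) hM
      rw [pow_succ, mul_assoc]
      exact Nat.mul_le_mul_left _ (by nlinarith)) (G t) ht
    refine ⟨Fin.cons t T, fun c => ?_⟩
    have := (mem_filter.1 (hT (Fin.tail c))).2 (c 0)
    convert this using 1
    ext i
    refine Fin.cases ?_ (fun i => ?_) i <;> simp [Fin.tail]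

/-- A `k`-uniform hypergraph with at most `s ^ 2` edges has a colouring with `k * s` colours in
which the vertices of each edge receive distinct colours. -/
theorem exists_strong_coloring {n k s : ℕ} (H : Finset (Finset (Fin n)))
    (hH : ∀ e ∈ H, e.card = k) (hk : 1 ≤ k) (hs : 1 ≤ s) (hm : H.card ≤ s ^ 2) :
    ∃ g : Fin n → Fin (k * s), ∀ e ∈ H, Set.InjOn g e := by
  classical
  have hks : 0 < k * s := by positivity
  let deg : Fin n → ℕ := fun v => (H.filter (v ∈ ·)).card
  set A : Finset (Fin n) := univ.filter fun v => s ≤ deg v with hA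
  have hAcard : A.card ≤ k * s := by
    have h1 : ∑ v, deg v = ∑ e ∈ H, e.card := by
      simp only [deg, card_filter]
      rw [sum_comm]
      refine sum_congr rfl fun e _ => ?_
      rw [← card_filter, filter_mem_eq_inter, univ_inter]
    have h2 : ∑ e ∈ H, e.card = H.card * k := by
      rw [sum_congr rfl hH, sum_const, smul_eq_mul]
    have h3 : A.card * s ≤ ∑ v, deg v := by
      rw [← smul_eq_mul, ← sum_const]
      refine (sum_le_sum fun v hv => (mem_filter.1 hv).2).trans ?_
      exact sum_le_sum_of_subset (subset_univ A)
    have h4 : A.card * s ≤ (k * s) * s := by nlinarith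
    exact Nat.le_of_mul_le_mul_right h4 hs
  have key : ∀ B : Finset (Fin n), (∀ v ∈ B, deg v < s) →
      ∃ g : Fin n → Fin (k * s), ∀ e ∈ H, Set.InjOn g (e ∩ (A ∪ B) : Finset (Fin n)) := by
    intro B
    induction B using Finset.induction_on with
    | empty =>
      intro _
      obtain ⟨ι⟩ : Nonempty (A ↪ Fin (k * s)) :=
        Function.Embedding.nonempty_of_card_le (by simpa using hAcard)
      refine ⟨fun v => if h : v ∈ A then ι ⟨v, h⟩ else ⟨0, hks⟩, fun e _ u hu v hv huv => ?_⟩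
      have hu' : u ∈ A := by simpa using (mem_inter.1 hu).2
      have hv' : v ∈ A := by simpa using (mem_inter.1 hv).2
      simp only [hu', hv', dif_pos] at huv
      exact congrArg Subtype.val (ι.injective huv)
    | insert v B hv ih =>
      intro hB
      obtain ⟨g, hg⟩ := ih fun u hu => hB u (mem_insert_of_mem hu)
      set Γ : Finset (Fin n) := (H.filter (v ∈ ·)).biUnion fun e => e.erase v
      have hΓ : (Γ.image g).card < (univ : Finset (Fin (k * s))).card := by
        rw [card_univ, Fintype.card_fin]
        have h1 : Γ.card ≤ deg v * (k - 1) := card_biUnion_le_card_mul _ _ _ fun e he => by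
          obtain ⟨he, hve⟩ := mem_filter.1 he
          rw [card_erase_of_mem hve, hH e he]
        have h2 : deg v * (k - 1) < k * s := by
          have := hB v (mem_insert_self _ _)
          have : deg v * (k - 1) ≤ deg v * k := Nat.mul_le_mul_left _ (Nat.sub_le _ _)
          nlinarith
        exact card_image_le.trans_lt (h1.trans_lt h2)
      obtain ⟨a, -, ha⟩ := exists_mem_notMem_of_card_lt_card hΓ
      have hfresh : ∀ e ∈ H, v ∈ e → ∀ u ∈ e, u ≠ v → g u ≠ a := by
        rintro e he hve u hu huv rfl
        exact ha (mem_image_of_mem _ (mem_biUnion.2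
          ⟨e, mem_filter.2 ⟨he, hve⟩, mem_erase.2 ⟨huv, hu⟩⟩))
      refine ⟨Function.update g v a, fun e he u hu w hw huw => ?_⟩
      obtain ⟨hue, hu⟩ := mem_inter.1 hu
      obtain ⟨hwe, hw⟩ := mem_inter.1 hw
      by_cases huv : u = v <;> by_cases hwv : w = v
      · rw [huv, hwv]
      · subst huv
        rw [Function.update_self, Function.update_of_ne hwv] at huw
        exact absurd huw.symm (hfresh e he hue w hwe hwv)
      · subst hwv
        rw [Function.update_self, Function.update_of_ne huv] at huw
        exact absurd huw (hfresh e he hwe u hue huv)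
      · rw [Function.update_of_ne huv, Function.update_of_ne hwv] at huw
        refine hg e he ?_ ?_ huw <;> simp_all
  obtain ⟨g, hg⟩ := key (univ.filter fun v => deg v < s) fun v hv => (mem_filter.1 hv).2
  refine ⟨g, fun e he => ?_⟩
  convert hg e he using 2
  ext v
  simp [hA, le_or_gt]

/-- In each transversal of `R` blocks there is a monochromatic clique on `l` blocks. -/
theorem exists_transversal_clique {q l j N : ℕ} {α : Type*} [DecidableEq α]
    (χ : Finset α → Fin q) (hN : 2 ^ ramseyExp q l j = N) (y : Fin N → α) :
    ∃ (σ : Fin l ↪ Fin N) (i : Fin q), ∀ e : Finset (Fin l), e.card = j + 2 →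
      χ (e.image fun a => y (σ a)) = i := by
  obtain ⟨S, hS, hl, i, hi⟩ := exists_monochromatic_clique l j
    (fun e => χ ((univ.filter fun a : Fin N => (a : ℕ) ∈ e).image y)) (range N)
    (by rw [card_range, hN])
  have hlt : ∀ a, S.orderEmbOfFin hl a < N := fun a =>
    mem_range.1 (hS (S.orderEmbOfFin_mem hl a))
  refine ⟨⟨fun a => ⟨S.orderEmbOfFin hl a, hlt a⟩, fun a b hab => ?_⟩, i, fun e he => ?_⟩
  · exact (S.orderEmbOfFin hl).injective (Fin.ext_iff.1 hab)
  · rw [← hi (e.image (S.orderEmbOfFin hl)) ?_ ?_]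
    · congr 1
      ext z
      simp only [mem_image, mem_filter, mem_univ, true_and]
      constructor
      · rintro ⟨a, ha, rfl⟩
        exact ⟨_, ⟨a, ha, rfl⟩, rfl⟩
      · rintro ⟨b, ⟨a, ha, hab⟩, rfl⟩
        refine ⟨a, ha, ?_⟩
        congr 1
        exact Fin.ext hab
    · intro z hz
      obtain ⟨a, -, rfl⟩ := mem_image.1 hz
      exact S.orderEmbOfFin_mem hl a
    · rw [card_image_of_injective _ (S.orderEmbOfFin hl).injective, he]

/-- Restricting functions to the range of an injection `σ : Fin l ↪ Fin R` identifies at most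
`M ^ (R - l)` of them. -/
theorem card_le_mul_card_image_comp {R M l : ℕ} (σ : Fin l ↪ Fin R)
    (F : Finset (Fin R → Fin M)) :
    F.card ≤ M ^ (R - l) * (F.image fun x => x ∘ σ).card := by
  classical
  refine card_le_mul_card_image F _ fun y _ => ?_
  let Z := {a : Fin R // a ∉ Set.range σ}
  have hZ : Fintype.card Z = R - l := by
    rw [Fintype.card_subtype_compl, Fintype.card_fin]
    congr 1
    rw [← Set.toFinset_card, Set.toFinset_range, card_image_of_injective _ σ.injective]
    simp
  have hcard : (univ : Finset (Z → Fin M)).card = M ^ (R - l) := by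
    rw [card_univ, Fintype.card_fun, Fintype.card_fin, hZ]
  rw [← hcard]
  refine card_le_card_of_injOn (fun x z => x z.1) (fun _ _ => mem_univ _) ?_
  intro x hx x' hx' hxx
  funext a
  by_cases ha : a ∈ Set.range σ
  · obtain ⟨b, rfl⟩ := ha
    have h1 := (mem_filter.1 hx).2
    have h2 := (mem_filter.1 hx').2
    exact congrFun (h1.trans h2.symm) b
  · exact congrFun hxx ⟨a, ha⟩

/-- A strongly `l`-colourable hypergraph has a monochromatic copy in every colouring of a
sufficiently large complete uniform hypergraph. -/
theorem exists_monochromatic_copy {q n l j M p R N : ℕ} (H : Finset (Finset (Fin n)))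
    (hH : ∀ e ∈ H, e.card = j + 2) (g : Fin n → Fin l) (hg : ∀ e ∈ H, Set.InjOn g e)
    (hn : 1 ≤ n) (hp : 1 ≤ p) (hR : 2 ^ ramseyExp q l j = R) (hP : q * R ^ l ≤ 2 ^ p)
    (hM : n * 2 ^ ((2 * n) ^ l * p) ≤ M) (hN : R * M ≤ N) (χ : Finset (Fin N) → Fin q) :
    ∃ f : Fin n → Fin N, Function.Injective f ∧ ∃ i : Fin q, ∀ e ∈ H, χ (e.image f) = i := by
  classical
  have hM0 : 0 < M := lt_of_lt_of_le (by positivity) hM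
  obtain ⟨φ⟩ : Nonempty (Fin R × Fin M ↪ Fin N) :=
    Function.Embedding.nonempty_of_card_le (by simpa using hN)
  choose σ i hσ using fun x : Fin R → Fin M =>
    exists_transversal_clique χ hR fun a => φ (a, x a)
  let pat : (Fin R → Fin M) → (Fin l → Fin R) × Fin q := fun x => (σ x, i x)
  obtain ⟨x₀, hx₀⟩ : ∃ x₀, M ^ R ≤ 2 ^ p * (univ.filter fun x => pat x = pat x₀).card := by
    by_contra! hcon
    have h0 : 0 < M ^ R := by positivity
    have hcon' : ∀ b, 2 ^ p * (univ.filter fun x => pat x = b).card < M ^ R := by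
      intro b
      by_cases hb : ∃ x, pat x = b
      · obtain ⟨x, rfl⟩ := hb
        exact hcon x
      · push Not at hb
        simpa [hb] using h0
    have h1 : 2 ^ p * M ^ R = ∑ b, 2 ^ p * (univ.filter fun x => pat x = b).card := by
      rw [← mul_sum, ← card_eq_sum_card_fiberwise (fun _ _ => mem_univ _)]
      simp
    have : Nonempty ((Fin l → Fin R) × Fin q) := ⟨pat fun _ => ⟨0, hM0⟩⟩
    have h2 := sum_lt_sum_of_nonempty univ_nonempty fun b _ => hcon' b
    rw [← h1, sum_const, card_univ, smul_eq_mul] at h2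
    simp only [Fintype.card_prod, Fintype.card_fun, Fintype.card_fin] at h2
    have h3 := Nat.mul_le_mul_right (M ^ R) hP
    rw [mul_comm q] at h3
    omega
  set F := univ.filter fun x => pat x = pat x₀
  have hlR : l ≤ R := by simpa using Fintype.card_le_of_embedding (σ x₀)
  have hE : M ^ l ≤ 2 ^ p * (F.image fun x => x ∘ σ x₀).card := by
    have h1 := hx₀.trans (Nat.mul_le_mul_left _ (card_le_mul_card_image_comp (σ x₀) F))
    rw [← pow_sub_mul_pow M hlR, mul_left_comm] at h1
    exact Nat.le_of_mul_le_mul_left h1 (by positivity)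
  obtain ⟨T, hT⟩ := exists_box hn l p hp hM _ hE
  refine ⟨fun v => φ (σ x₀ (g v), T (g v) v), fun u v huv => ?_, i x₀, fun e he => ?_⟩
  · obtain ⟨h1, h2⟩ := Prod.mk.inj (φ.injective huv)
    have h3 := (σ x₀).injective h1
    rw [h3] at h2
    exact (T (g v)).injective h2
  · have : Nonempty (Fin n) := ⟨⟨0, hn⟩⟩
    have hinv : ∀ v ∈ e, Function.invFunOn g e (g v) = v := fun v hv =>
      (hg e he).leftInvOn_invFunOn hv
    obtain ⟨x, hx, hxT⟩ := mem_image.1 (hT (Function.invFunOn g e))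
    obtain ⟨hx1, hx2⟩ := Prod.mk.inj (mem_filter.1 hx).2
    have h1 := hσ x (e.image g) (by rw [card_image_of_injOn (hg e he), hH e he])
    rw [hx2, image_image] at h1
    rw [← h1]
    congr 1
    refine image_congr fun v hv => ?_
    have h2 := congrFun hxT (g v)
    simp only [Function.comp_apply, hinv v hv] at h2 ⊢
    rw [hx1, h2]

theorem le_two_rpow (x : ℝ) : x ≤ (2 : ℝ) ^ x := by
  rcases le_or_gt x 0 with h | h
  · exact h.trans (by positivity)
  · calc x ≤ (⌊x⌋₊ : ℝ) + 1 := (Nat.lt_floor_add_one x).le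
      _ ≤ (2 : ℝ) ^ ⌊x⌋₊ := by exact_mod_cast Nat.lt_two_pow_self
      _ = (2 : ℝ) ^ (⌊x⌋₊ : ℝ) := (Real.rpow_natCast _ _).symm
      _ ≤ (2 : ℝ) ^ x := Real.rpow_le_rpow_of_exponent_le one_le_two (Nat.floor_le h.le)

theorem tower_mono (i : ℕ) : Monotone (tower i) := by
  induction i with
  | zero => exact fun x y h => h
  | succ i ih => exact fun x y h => Real.rpow_le_rpow_of_exponent_le one_le_two (ih h)

theorem tower_le_tower_of_le {i j : ℕ} (h : i ≤ j) (x : ℝ) : tower i x ≤ tower j x :=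
  monotone_nat_of_le_succ (f := fun i => tower i x) (fun i => le_two_rpow (tower i x)) h

theorem mul_tower_le {C : ℕ} (hC : 1 ≤ C) {x : ℝ} (hx : 1 ≤ x) (i : ℕ) :
    C * tower i x ≤ tower i (C * x) := by
  induction i with
  | zero => exact le_rfl
  | succ i ih =>
    have h1 : 1 ≤ tower i x := hx.trans (tower_le_tower_of_le (Nat.zero_le i) x)
    refine le_trans ?_ (Real.rpow_le_rpow_of_exponent_le one_le_two ih)
    obtain ⟨C, rfl⟩ : ∃ D, C = D + 1 := ⟨C - 1, by omega⟩
    have h2 : ((C + 1 : ℕ) : ℝ) ≤ (2 : ℝ) ^ (C * tower i x) := by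
      calc ((C + 1 : ℕ) : ℝ) ≤ (2 : ℝ) ^ C := by exact_mod_cast Nat.lt_two_pow_self
        _ = (2 : ℝ) ^ (C : ℝ) := (Real.rpow_natCast _ _).symm
        _ ≤ _ := Real.rpow_le_rpow_of_exponent_le one_le_two
          (le_mul_of_one_le_right (Nat.cast_nonneg C) h1)
    calc ((C + 1 : ℕ) : ℝ) * tower (i + 1) x ≤ (2 : ℝ) ^ (C * tower i x) * 2 ^ tower i x :=
          mul_le_mul_of_nonneg_right h2 (Real.rpow_nonneg zero_le_two _)
      _ = 2 ^ (((C + 1 : ℕ) : ℝ) * tower i x) := by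
          rw [← Real.rpow_add zero_lt_two]
          push_cast
          ring_nf

theorem tower_pow_le {C : ℕ} (hC : 1 ≤ C) {x : ℝ} (hx : 1 ≤ x) (i : ℕ) :
    tower (i + 1) x ^ C ≤ tower (i + 1) (C * x) := by
  have h : tower (i + 1) x ^ C = 2 ^ (C * tower i x) := by
    rw [mul_comm, Real.rpow_mul zero_le_two, Real.rpow_natCast]
    rfl
  rw [h]
  exact Real.rpow_le_rpow_of_exponent_le one_le_two (mul_tower_le hC hx i)

/-- The multicolour Ramsey number of the complete `(j+2)`-uniform hypergraph on `l` vertices is at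
most a tower of height `j + 2` in `O(l)`. -/
theorem exists_ramseyExp_le_tower {q : ℕ} (hq : 1 ≤ q) (j : ℕ) :
    ∃ c : ℕ, 1 ≤ c ∧ ∀ l : ℕ, 1 ≤ l → (ramseyExp q l j : ℝ) ≤ tower j (c * l) := by
  induction j with
  | zero =>
    refine ⟨q * (q + 1), by nlinarith, fun l hl => ?_⟩
    have : ramseyExp q l 0 ≤ q * (q + 1) * l := by
      simp only [ramseyExp]
      nlinarith
    simp only [tower]
    exact_mod_cast this
  | succ j ih =>
    obtain ⟨c, hc, h⟩ := ih
    set C := q + 2 * (j + 2)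
    refine ⟨C * c, Nat.mul_pos (by omega) hc, fun l hl => ?_⟩
    have hpos : 1 ≤ ramseyExp q l j := by
      cases j <;> exact Nat.mul_pos hq (by positivity)
    have h1 : ramseyExp q l (j + 1) ≤ (2 ^ ramseyExp q l j) ^ C := by
      have h2 : 2 ≤ 2 ^ ramseyExp q l j := Nat.le_self_pow (by omega) 2
      have h3 : 2 ^ ramseyExp q l j + 1 ≤ (2 ^ ramseyExp q l j) ^ 2 := by nlinarith
      calc ramseyExp q l (j + 1) = q * (2 ^ ramseyExp q l j + 1) ^ (j + 2) := rfl
        _ ≤ (2 ^ ramseyExp q l j) ^ q * ((2 ^ ramseyExp q l j) ^ 2) ^ (j + 2) :=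
          Nat.mul_le_mul (Nat.lt_two_pow_self.le.trans (Nat.pow_le_pow_left h2 q))
            (Nat.pow_le_pow_left h3 _)
        _ = _ := by rw [← pow_mul _ 2, ← pow_add]
    have h2 : (2 : ℝ) ^ ramseyExp q l j ≤ tower (j + 1) (c * l) := by
      rw [← Real.rpow_natCast]
      exact Real.rpow_le_rpow_of_exponent_le one_le_two (h l hl)
    have hcl : (1 : ℝ) ≤ c * l := by exact_mod_cast Nat.mul_pos hc hl
    calc (ramseyExp q l (j + 1) : ℝ) ≤ ((2 : ℝ) ^ ramseyExp q l j) ^ C := by exact_mod_cast h1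
      _ ≤ tower (j + 1) (c * l) ^ C := pow_le_pow_left₀ (by positivity) h2 C
      _ ≤ tower (j + 1) (C * (c * l)) := tower_pow_le (by omega) hcl j
      _ = _ := by rw [Nat.cast_mul, mul_assoc]

/-- A strongly `l`-colourable hypergraph has a monochromatic copy once the number of vertices is
at least `2 ^ tower (i + 1) (5 * x)`, where `tower (i + 1) x` bounds the relevant parameters. -/
theorem exists_monochromatic_copy_of_tower_le {q n l j i N : ℕ} {x : ℝ}
    (H : Finset (Finset (Fin n)))
    (hH : ∀ e ∈ H, e.card = j + 2) (g : Fin n → Fin l) (hg : ∀ e ∈ H, Set.InjOn g e)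
    (hn : 1 ≤ n) (hl : 1 ≤ l) (hq : 1 ≤ q) (hx : 1 ≤ x)
    (hqT : (q : ℝ) ≤ tower (i + 1) x) (hlT : (l : ℝ) ≤ tower (i + 1) x)
    (hET : (ramseyExp q l j : ℝ) ≤ tower (i + 1) x)
    (hnT : ((2 * n : ℝ)) ^ l ≤ tower (i + 1) x)
    (hN : tower (i + 2) (5 * x) ≤ N) (χ : Finset (Fin N) → Fin q) :
    ∃ f : Fin n → Fin N, Function.Injective f ∧ ∃ i : Fin q, ∀ e ∈ H, χ (e.image f) = i := by
  set E := ramseyExp q l j with hE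
  set T := tower (i + 1) x with hT
  have hT2 : 2 ≤ T := by
    refine le_trans ?_ (tower_le_tower_of_le (show 1 ≤ i + 1 by omega) x)
    calc (2 : ℝ) = 2 ^ (1 : ℝ) := by simp
      _ ≤ 2 ^ x := Real.rpow_le_rpow_of_exponent_le one_le_two hx
  refine exists_monochromatic_copy (p := q + E * l) H hH g hg hn (by omega) rfl ?_ le_rfl ?_ χ
  · rw [pow_add, ← pow_mul]
    exact Nat.mul_le_mul_right _ Nat.lt_two_pow_self.le
  · have h1 : 2 ^ E * (n * 2 ^ ((2 * n) ^ l * (q + E * l)))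
        ≤ 2 ^ (E + n + (2 * n) ^ l * (q + E * l)) := by
      rw [pow_add, pow_add, mul_assoc]
      exact Nat.mul_le_mul_left _ (Nat.mul_le_mul_right _ Nat.lt_two_pow_self.le)
    have hnT' : (n : ℝ) ≤ T := by
      refine le_trans ?_ hnT
      have : n ≤ (2 * n) ^ l := le_trans (by omega) (Nat.le_self_pow (by omega) (2 * n))
      exact_mod_cast this
    have h2 : ((E + n + (2 * n) ^ l * (q + E * l) : ℕ) : ℝ) ≤ T ^ 5 := by
      push_cast
      calc (E : ℝ) + n + (2 * n) ^ l * (q + E * l) ≤ T + T + T * (T + T * T) := by gcongr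
        _ ≤ T ^ 5 := by
          have h3 : T + T ≤ T ^ 2 := by nlinarith
          have h4 : T + T * T ≤ T ^ 3 := by nlinarith
          have h5 : T ^ 2 ≤ T ^ 4 := pow_le_pow_right₀ (by linarith) (by norm_num)
          have h6 : T * T ^ 4 = T ^ 5 := by ring
          have h7 : T * T ^ 3 = T ^ 4 := by ring
          nlinarith [mul_le_mul_of_nonneg_left h4 (by linarith : 0 ≤ T),
            pow_pos (by linarith : 0 < T) 4]
    have h3 : ((2 ^ (E + n + (2 * n) ^ l * (q + E * l)) : ℕ) : ℝ) ≤ N := by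
      refine le_trans ?_ hN
      rw [Nat.cast_pow, Nat.cast_ofNat, ← Real.rpow_natCast]
      exact Real.rpow_le_rpow_of_exponent_le one_le_two
        (h2.trans (by exact_mod_cast tower_pow_le (C := 5) (by norm_num) hx i))
    exact h1.trans (by exact_mod_cast h3)

/-- For all k ≥ 3 and q ≥ 2 there is a constant c > 0 depending only on k and q
such that the q-colour Ramsey number of any k-uniform hypergraph H with m ≥ 2 edges and no
isolated vertices satisfies r(H,...,H) ≤ t_k(c·√m) for k ≥ 4 and r(H,...,H) ≤ t_3(c·√m·log m)
for k = 3 (here t_k = tower (k-1)). -/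
theorem stmt_11 :
    ∀ k q : ℕ, 3 ≤ k → 2 ≤ q →
    ∃ c : ℝ, 0 < c ∧
      ∀ (n : ℕ) (H : Finset (Finset (Fin n))),
        (∀ e ∈ H, e.card = k) →
        (∀ v : Fin n, ∃ e ∈ H, v ∈ e) →
        2 ≤ H.card →
        ((4 ≤ k →
          ∀ N : ℕ, tower (k - 1) (c * Real.sqrt H.card) ≤ (N : ℝ) →
            ∀ χ : Finset (Fin N) → Fin q,
              ∃ f : Fin n → Fin N, Function.Injective f ∧
                ∃ i : Fin q, ∀ e ∈ H, χ (e.image f) = i) ∧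
         (k = 3 →
          ∀ N : ℕ, tower 2 (c * Real.sqrt H.card * Real.log H.card) ≤ (N : ℝ) →
            ∀ χ : Finset (Fin N) → Fin q,
              ∃ f : Fin n → Fin N, Function.Injective f ∧
                ∃ i : Fin q, ∀ e ∈ H, χ (e.image f) = i)) := by
  classical
  intro k q hk hq
  obtain ⟨j, rfl⟩ : ∃ j, k = j + 2 := ⟨k - 2, by omega⟩
  obtain ⟨c, hc, hcE⟩ := exists_ramseyExp_le_tower (q := q) (by omega) j
  set C : ℕ := q + 6 * c + 2 * (j + 2) + 48
  have hCpos : 0 < C := by omega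
  refine ⟨5 * C * (2 * (j + 2)), by positivity, fun n H hH hcov hm => ?_⟩
  set m := H.card
  set s := Nat.sqrt m + 1 with hs
  have hms : m ≤ s ^ 2 := (Nat.lt_succ_sqrt' m).le
  have hnm : n ≤ m * (j + 2) := by
    have h1 : (univ : Finset (Fin n)) ⊆ H.biUnion id := fun v _ => by
      obtain ⟨e, he, hv⟩ := hcov v
      exact mem_biUnion.2 ⟨e, he, hv⟩
    simpa using (card_le_card h1).trans
      (card_biUnion_le_card_mul H id (j + 2) fun e he => (hH e he).le)
  have hn : 1 ≤ n := by
    obtain ⟨e, he⟩ : H.Nonempty := card_pos.1 (by omega)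
    have h1 := card_le_univ e
    rw [hH e he, Fintype.card_fin] at h1
    omega
  set l := (j + 2) * s with hl
  obtain ⟨g, hg⟩ : ∃ g : Fin n → Fin l, ∀ e ∈ H, Set.InjOn g e :=
    exists_strong_coloring H hH (by omega) (by omega : 1 ≤ s) hms
  have hl1 : 1 ≤ l := Nat.mul_pos (by omega) (by omega)
  have hm1 : (2 : ℝ) ≤ m := by exact_mod_cast hm
  have hsqrt : 1 ≤ √(m : ℝ) := Real.one_le_sqrt.2 (by linarith)
  have hls : (l : ℝ) ≤ 2 * (j + 2) * √m := by
    have h1 : (s : ℝ) ≤ 2 * √m := by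
      have := Real.nat_sqrt_le_real_sqrt (a := m)
      rw [hs]
      push_cast
      linarith
    rw [hl]
    push_cast
    nlinarith [Nat.cast_nonneg (α := ℝ) j]
  have hl1' : (1 : ℝ) ≤ l := by exact_mod_cast hl1
  constructor
  · intro hk4 N hN χ
    obtain ⟨i, rfl⟩ : ∃ i, j = i + 2 := ⟨j - 2, by omega⟩
    have hC1 : (1 : ℝ) ≤ C := by exact_mod_cast hCpos
    have hxl : (l : ℝ) ≤ C * l := le_mul_of_one_le_left (by linarith) hC1
    have hx : (1 : ℝ) ≤ C * l := hl1'.trans hxl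
    have hself : C * (l : ℝ) ≤ tower (i + 2) (C * l) := tower_le_tower_of_le (Nat.zero_le _) _
    refine exists_monochromatic_copy_of_tower_le (i := i + 1) (x := C * l) H hH g hg hn hl1
      (by omega) hx ?_ (hxl.trans hself) ?_ ?_ ?_ χ
    · refine le_trans ?_ hself
      have : q ≤ C * l := le_trans (by omega) (Nat.le_mul_of_pos_right C hl1)
      exact_mod_cast this
    · refine (hcE l hl1).trans (tower_mono _ ?_)
      gcongr
      omega
    · have h1 : (2 * n) ^ l ≤ 2 ^ (2 ^ (C * l)) := by
        have h2 : 2 * n * l ≤ 2 ^ (C * l) := by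
          have h3 : m ≤ l ^ 2 :=
            hms.trans (Nat.pow_le_pow_left (Nat.le_mul_of_pos_left _ (by omega)) 2)
          calc 2 * n * l ≤ 2 * (l ^ 2 * (i + 2 + 2)) * l := by gcongr; exact hnm.trans (by gcongr)
            _ = (2 * (i + 2 + 2)) * l ^ 3 := by ring
            _ ≤ 2 ^ (2 * (i + 2 + 2)) * (2 ^ l) ^ 3 :=
              Nat.mul_le_mul Nat.lt_two_pow_self.le (Nat.pow_le_pow_left Nat.lt_two_pow_self.le 3)
            _ = 2 ^ (2 * (i + 2 + 2) + l * 3) := by rw [← pow_mul, ← pow_add]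
            _ ≤ 2 ^ (C * l) := by
              refine Nat.pow_le_pow_right (by omega) ?_
              have h4 : 2 * (i + 2 + 2) + 3 ≤ C := by omega
              nlinarith
        calc (2 * n) ^ l ≤ (2 ^ (2 * n)) ^ l := Nat.pow_le_pow_left Nat.lt_two_pow_self.le _
          _ = 2 ^ (2 * n * l) := (pow_mul _ _ _).symm
          _ ≤ _ := Nat.pow_le_pow_right (by omega) h2
      have h2 : (2 : ℝ) ^ 2 ^ (C * l) = tower 2 (C * l) := by
        simp only [tower]
        rw [← Nat.cast_mul, Real.rpow_natCast, ← Real.rpow_natCast 2 (2 ^ (C * l))]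
        push_cast
        rfl
      refine le_trans ?_ (tower_le_tower_of_le (show 2 ≤ i + 1 + 1 by omega) _)
      rw [← h2]
      exact_mod_cast h1
    · refine le_trans (tower_mono _ ?_) hN
      calc 5 * (C * (l : ℝ)) ≤ 5 * (C * (2 * ((i + 2 : ℕ) + 2) * √m)) := by gcongr
        _ = _ := by ring
  · intro hk3 N hN χ
    obtain rfl : j = 1 := by omega
    have hlog : 1 / 2 ≤ Real.log m :=
      le_trans (by linarith [Real.log_two_gt_d9]) (Real.log_le_log zero_lt_two hm1)
    set u := 2 * √m * Real.log m with hu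
    have hsu : √m ≤ u := by nlinarith
    have hu1 : 1 ≤ u := hsqrt.trans hsu
    have hlu : (l : ℝ) ≤ 6 * u := by
      refine hls.trans ?_
      push_cast
      linarith
    have hCu : (C : ℝ) = q + 6 * c + 54 := by
      simp only [C]
      push_cast
      ring
    have hq0 : (0 : ℝ) ≤ q := Nat.cast_nonneg q
    have hc0 : (0 : ℝ) ≤ c := Nat.cast_nonneg c
    have hx : 1 ≤ C * u := by nlinarith
    refine exists_monochromatic_copy_of_tower_le (i := 0) (x := C * u) H hH g hg hn hl1
      (by omega) hx ?_ ?_ ?_ ?_ ?_ χ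
    · exact le_trans (by nlinarith) (le_two_rpow (C * u))
    · exact le_trans (by nlinarith) (le_two_rpow (C * u))
    · exact (hcE l hl1).trans (tower_mono _ (by nlinarith))
    · have h1 : (2 * n : ℝ) ≤ m ^ 4 := by
        have h2 : (n : ℝ) ≤ m * 3 := by exact_mod_cast hnm
        have h3 : (2 : ℝ) ^ 3 ≤ m ^ 3 := pow_le_pow_left₀ zero_le_two hm1 3
        nlinarith
      have h2 : (m : ℝ) ≤ 2 ^ (2 * Real.log m) := by
        rw [Real.rpow_def_of_pos zero_lt_two]
        nth_rewrite 1 [← Real.exp_log (by linarith : (0 : ℝ) < m)]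
        exact Real.exp_le_exp.2 (by nlinarith [Real.log_two_gt_d9])
      calc (2 * n : ℝ) ^ l ≤ (((2 : ℝ) ^ (2 * Real.log m)) ^ 4) ^ l := by
            gcongr
            exact h1.trans (pow_le_pow_left₀ (by linarith) h2 4)
        _ = 2 ^ (8 * l * Real.log m) := by
            rw [← pow_mul, ← Real.rpow_mul_natCast zero_le_two]
            push_cast
            ring_nf
        _ ≤ 2 ^ (C * u) := by
            refine Real.rpow_le_rpow_of_exponent_le one_le_two ?_
            have h3 : l * Real.log m ≤ 6 * √m * Real.log m := by
              refine mul_le_mul_of_nonneg_right (hls.trans ?_) (by linarith)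
              push_cast
              linarith
            nlinarith
    · refine le_trans (tower_mono _ ?_) hN
      calc 5 * (C * u) ≤ 3 * (5 * (C * u)) := by linarith
        _ = _ := by
          rw [hu]
          push_cast
          ring
end

section
/- Every k-uniform hypergraph H with m edges and no isolated vertices has strong chromatic number at most k·√m. -/
open Finset

/-- A strong colouring with the least number of colours uses every pair of distinct colours
inside some edge, since otherwise the two colours could be merged. -/
theorem exists_strong_coloring_forall_pair {V : Type*} [Fintype V] (H : Finset (Finset V)) :
    ∃ (t : ℕ) (κ : V → Fin t),
      (∀ e ∈ H, ∀ u ∈ e, ∀ v ∈ e, u ≠ v → κ u ≠ κ v) ∧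
        ∀ i j : Fin t, i ≠ j → ∃ e ∈ H, ∃ u ∈ e, ∃ v ∈ e, κ u = i ∧ κ v = j := by
  classical
  let P : ℕ → Prop := fun t ↦
    ∃ κ : V → Fin t, ∀ e ∈ H, ∀ u ∈ e, ∀ v ∈ e, u ≠ v → κ u ≠ κ v
  have hP : ∃ t, P t :=
    ⟨Fintype.card V, Fintype.equivFin V, fun _ _ _ _ _ _ huv h ↦
      huv ((Fintype.equivFin V).injective h)⟩
  obtain ⟨κ, hκ⟩ := Nat.find_spec hP
  refine ⟨Nat.find hP, κ, hκ, fun i j hij ↦ ?_⟩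
  by_contra! hno
  have hcard : Fintype.card {c : Fin (Nat.find hP) // c ≠ j} < Nat.find hP := by
    simpa using Fintype.card_subtype_lt (p := fun c : Fin (Nat.find hP) ↦ c ≠ j) (x := j) (by simp)
  refine Nat.find_min hP hcard ⟨fun v ↦ Fintype.equivFin _
    (if h : κ v = j then ⟨i, hij⟩ else ⟨κ v, h⟩), fun e he u hu v hv huv h ↦ ?_⟩
  have h' := congrArg Subtype.val ((Fintype.equivFin _).injective h)
  have h₁ := hκ e he u hu v hv huv
  have h₂ := hno e he u hu v hv
  have h₃ := hno e he v hv u hu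
  split_ifs at h' <;> simp_all

/-- The number of ordered pairs of colours in a colouring that uses every pair of distinct colours
inside some edge is at most the number of ordered pairs of vertices inside edges. -/
theorem card_color_pairs_le {V : Type*} {k t : ℕ} (H : Finset (Finset V))
    (hk : ∀ e ∈ H, e.card = k) (κ : V → Fin t)
    (hκ : ∀ i j : Fin t, i ≠ j → ∃ e ∈ H, ∃ u ∈ e, ∃ v ∈ e, κ u = i ∧ κ v = j) :
    t * t - t ≤ H.card * (k * k - k) := by
  classical
  have hsub : (univ : Finset (Fin t)).offDiag ⊆
      (H.biUnion offDiag).image (Prod.map κ κ) := by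
    rintro ⟨i, j⟩ hij
    have hij : i ≠ j := by simpa using hij
    obtain ⟨e, he, u, hu, v, hv, rfl, rfl⟩ := hκ i j hij
    exact mem_image.2 ⟨(u, v), mem_biUnion.2 ⟨e, he, mem_offDiag.2
      ⟨hu, hv, fun h ↦ hij (congrArg κ h)⟩⟩, rfl⟩
  calc t * t - t = #(univ : Finset (Fin t)).offDiag := by simp [offDiag_card]
    _ ≤ #(H.biUnion offDiag) := (card_le_card hsub).trans card_image_le
    _ ≤ H.card * (k * k - k) := card_biUnion_le_card_mul _ _ _ fun e he ↦ by
      rw [offDiag_card, hk e he]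

theorem le_mul_sqrt_of_mul_self_sub_le {k m t : ℕ} (hk : 1 ≤ k) (hm : 1 ≤ m)
    (h : t * t - t ≤ m * (k * k - k)) : (t : ℝ) ≤ k * Real.sqrt m := by
  have h' : (t : ℝ) * t - t ≤ m * (k * k - k) := by
    have := (Nat.cast_le (α := ℝ)).2 h
    rwa [Nat.cast_mul, Nat.cast_sub (Nat.le_mul_self t), Nat.cast_sub (Nat.le_mul_self k),
      Nat.cast_mul, Nat.cast_mul] at this
  have hk' : (1 : ℝ) ≤ k := by exact_mod_cast hk
  have hs : (1 : ℝ) ≤ Real.sqrt m := Real.one_le_sqrt.2 (by exact_mod_cast hm)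
  have hsq : Real.sqrt m * Real.sqrt m = m := Real.mul_self_sqrt m.cast_nonneg
  rw [← hsq] at h'
  set s := Real.sqrt m
  by_contra! hlt
  have hks : 1 ≤ k * s := one_le_mul_of_one_le_of_one_le hk' hs
  have h₁ : 0 < (t - k * s) * (t + k * s - 1) := mul_pos (by linarith) (by linarith)
  have h₂ : 0 ≤ k * s * (s - 1) := mul_nonneg (by linarith) (by linarith)
  nlinarith

/-- Every k-uniform hypergraph H with m edges and no isolated vertices has
strong chromatic number at most k·√m: there is a number t of colours with t ≤ k·√m and a
colouring of the vertices with t colours in which no edge contains two vertices of the same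
colour. -/
theorem stmt_12 :
    ∀ (k n : ℕ) (H : Finset (Finset (Fin n))),
      (∀ e ∈ H, e.card = k) →
      (∀ v : Fin n, ∃ e ∈ H, v ∈ e) →
      ∃ t : ℕ, (t : ℝ) ≤ (k : ℝ) * Real.sqrt H.card ∧
        ∃ κ : Fin n → Fin t, ∀ e ∈ H, ∀ u ∈ e, ∀ v ∈ e, u ≠ v → κ u ≠ κ v := by
  intro k n H hk hcover
  obtain rfl | hn := Nat.eq_zero_or_pos n
  · exact ⟨0, by simpa using by positivity, id, fun _ _ u ↦ u.elim0⟩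
  obtain ⟨e, he, hv⟩ := hcover ⟨0, hn⟩
  obtain ⟨t, κ, hκ, hpair⟩ := exists_strong_coloring_forall_pair H
  refine ⟨t, le_mul_sqrt_of_mul_self_sub_le ?_ (card_pos.2 ⟨e, he⟩)
    (card_color_pairs_le H hk κ hpair), κ, hκ⟩
  exact hk e he ▸ card_pos.2 ⟨_, hv⟩
end

section
/- Let G be an l-uniform hypergraph on a vertex set of size N, where l divides N and l ≥ 1. Then there exists a partition of the vertex set into l parts V_1,...,V_l, each of size N/l, such that the number of edges of G containing exactly one vertex from each part is at least (l!/l^l) times the total number of edges of G. -/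
open Finset

/-- Any two finite subsets of equal size are exchanged by a permutation. -/
theorem exists_perm_map_eq {V : Type*} [Fintype V] [DecidableEq V] {s t : Finset V}
    (h : s.card = t.card) : ∃ τ : Equiv.Perm V, s.map τ.toEmbedding = t := by
  let f : {x // x ∈ s} ≃ {x // x ∈ t} := Finset.equivOfCardEq h
  refine ⟨f.extendSubtype, Finset.eq_of_subset_of_card_le ?_ (by simp [h])⟩
  intro y hy
  obtain ⟨x, hx, rfl⟩ := Finset.mem_map.1 hy
  exact f.extendSubtype_mem x hx

/-- The number of permutations carrying `e` into a family `T` depends only on `e.card`. -/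
theorem card_perm_map_mem_eq {V : Type*} [Fintype V] [DecidableEq V] (T : Finset (Finset V))
    {s t : Finset V} (h : s.card = t.card) :
    (univ.filter fun σ : Equiv.Perm V => s.map σ.toEmbedding ∈ T).card =
      (univ.filter fun σ : Equiv.Perm V => t.map σ.toEmbedding ∈ T).card := by
  obtain ⟨τ, rfl⟩ := exists_perm_map_eq h
  refine Finset.card_equiv (Equiv.mulRight τ⁻¹) fun σ => ?_
  have : (s.map τ.toEmbedding).map (σ * τ⁻¹).toEmbedding = s.map σ.toEmbedding := by
    rw [Finset.map_map]
    congr 1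
    ext x
    simp
  simp only [mem_filter, mem_univ, true_and, Equiv.coe_mulRight, this]

/-- Averaging over permutations: some permutation carries at least the expected number of
members of `G` into `T`. -/
theorem exists_perm_card_mul_card_le {V : Type*} [Fintype V] [DecidableEq V] {l : ℕ}
    {G T : Finset (Finset V)} (hG : ∀ e ∈ G, e.card = l) (hT : ∀ e ∈ T, e.card = l) :
    ∃ σ : Equiv.Perm V, G.card * T.card ≤
      (G.filter fun e => e.map σ.toEmbedding ∈ T).card * (Fintype.card V).choose l := by
  let A : Finset V → ℕ := fun e =>
    (univ.filter fun σ : Equiv.Perm V => e.map σ.toEmbedding ∈ T).card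
  have double (H : Finset (Finset V)) :
      ∑ σ : Equiv.Perm V, (H.filter fun e => e.map σ.toEmbedding ∈ T).card = ∑ e ∈ H, A e := by
    simp only [A, Finset.card_filter]
    exact Finset.sum_comm
  have all (σ : Equiv.Perm V) :
      ((powersetCard l univ).filter fun e => e.map σ.toEmbedding ∈ T).card = T.card := by
    refine Finset.card_equiv (Equiv.finsetCongr σ) fun e => ?_
    simp only [mem_filter, mem_powersetCard, subset_univ, true_and, Equiv.finsetCongr_apply]
    exact ⟨fun h => h.2, fun h => ⟨by simpa using hT _ h, h⟩⟩
  have total := double (powersetCard l univ)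
  simp only [all, sum_const, smul_eq_mul] at total
  have weight (e : Finset V) (he : e.card = l) :
      A e * (Fintype.card V).choose l = (univ : Finset (Equiv.Perm V)).card * T.card := by
    rw [total, Finset.sum_const_nat (m := A e), card_powersetCard, card_univ, mul_comm]
    intro x hx
    exact card_perm_map_mem_eq T ((mem_powersetCard.1 hx).2.trans he.symm)
  have average := Finset.exists_le_of_sum_le (s := (univ : Finset (Equiv.Perm V)))
    (f := fun _ => G.card * T.card)
    (g := fun σ => (G.filter fun e => e.map σ.toEmbedding ∈ T).card * (Fintype.card V).choose l)
    univ_nonempty (by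
      rw [sum_const, smul_eq_mul, ← Finset.sum_mul, double, Finset.sum_mul,
        Finset.sum_congr rfl fun e he => weight e (hG e he)]
      rw [sum_const, smul_eq_mul]
      exact (mul_left_comm _ _ _).le)
  obtain ⟨σ, -, hσ⟩ := average
  exact ⟨σ, hσ⟩

/-- A colouring of `V` whose classes are the fibres of `V ≃ ι × κ` has at least
`|κ| ^ |ι|` transversals. -/
theorem card_pow_le_card_transversals {V ι κ : Type*} [Fintype V] [DecidableEq V] [Fintype ι]
    [DecidableEq ι] [Fintype κ] (q : V ≃ ι × κ) :
    Fintype.card κ ^ Fintype.card ι ≤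
      (univ.filter fun e : Finset V =>
        ∀ j : ι, (e.filter fun v => (q v).1 = j).card = 1).card := by
  rw [← Fintype.card_fun, ← Finset.card_univ]
  refine Finset.card_le_card_of_injOn
    (fun f : ι → κ => univ.image fun j => q.symm (j, f j)) ?_ ?_
  · intro f _
    simp only [coe_filter, mem_univ, true_and, Set.mem_ofPred_eq]
    intro j
    rw [Finset.card_eq_one]
    refine ⟨q.symm (j, f j), ?_⟩
    ext v
    simp only [mem_filter, mem_image, mem_univ, true_and, mem_singleton]
    constructor
    · rintro ⟨⟨i, rfl⟩, h⟩
      simp only [Equiv.apply_symm_apply] at h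
      rw [h]
    · rintro rfl
      exact ⟨⟨j, rfl⟩, by simp⟩
  · intro f _ g _ h
    funext j
    have hj : q.symm (j, f j) ∈ univ.image fun j => q.symm (j, g j) := by
      change _ = univ.image fun j => q.symm (j, g j) at h
      rw [← h]
      exact mem_image_of_mem _ (mem_univ j)
    obtain ⟨i, -, hi⟩ := mem_image.1 hj
    have := q.symm.injective hi
    simp only [Prod.mk.injEq] at this
    obtain ⟨rfl, h2⟩ := this
    exact h2.symm

/-- Let G be an l-uniform hypergraph on a vertex set of size N, where l ≥ 1 and
l divides N. Then there is a partition of the vertex set into l parts of size N/l each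
(given by a colouring p of the vertices with l colours whose colour classes all have size N/l)
such that the number of edges of G with exactly one vertex in each part is at least
(l!/l^l)·|E(G)|. -/
theorem stmt_16 :
    ∀ l N : ℕ, 1 ≤ l → l ∣ N →
    ∀ G : Finset (Finset (Fin N)),
      (∀ e ∈ G, e.card = l) →
      ∃ p : Fin N → Fin l,
        (∀ j : Fin l, (Finset.univ.filter fun v => p v = j).card = N / l) ∧
        (l.factorial : ℝ) / (l : ℝ) ^ l * (G.card : ℝ) ≤
          ((G.filter fun e => ∀ j : Fin l, (e.filter fun v => p v = j).card = 1).card : ℝ) := by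
  rintro l _ hl ⟨m, rfl⟩ G hG
  let q : Fin (l * m) ≃ Fin l × Fin m := finProdFinEquiv.symm
  let T : Finset (Finset (Fin (l * m))) :=
    univ.filter fun e => ∀ j : Fin l, (e.filter fun v => (q v).1 = j).card = 1
  have hT : ∀ e ∈ T, e.card = l := by
    intro e he
    rw [Finset.card_eq_sum_card_fiberwise (f := fun v => (q v).1) (t := univ)
      fun _ _ => mem_coe.2 (mem_univ _), Finset.sum_congr rfl fun j _ => (mem_filter.1 he).2 j]
    simp
  have hTm : m ^ l ≤ T.card := by
    convert card_pow_le_card_transversals q <;> simp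
  obtain ⟨σ, hσ⟩ := exists_perm_card_mul_card_le hG hT
  refine ⟨fun v => (q (σ v)).1, fun j => ?_, ?_⟩
  · rw [Nat.mul_div_cancel_left m hl]
    have : (univ.filter fun v => (q (σ v)).1 = j).card = (({j} : Finset (Fin l)) ×ˢ
        (univ : Finset (Fin m))).card :=
      Finset.card_equiv (σ.trans q) fun v => by
        simp only [mem_filter, mem_univ, true_and, mem_product, mem_singleton, and_true]
        rfl
    simpa using this
  have hfilter : (G.filter fun e => ∀ j : Fin l, (e.filter fun v => (q (σ v)).1 = j).card = 1) =
      G.filter fun e => e.map σ.toEmbedding ∈ T := by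
    refine Finset.filter_congr fun e _ => ?_
    simp only [T, mem_filter, mem_univ, true_and, Finset.filter_map, card_map]
    rfl
  rw [hfilter]
  set X := (G.filter fun e => e.map σ.toEmbedding ∈ T).card
  rw [Fintype.card_fin] at hσ
  rcases Nat.eq_zero_or_pos m with rfl | hm
  · have : G = ∅ := Finset.eq_empty_of_forall_notMem fun e he => by
      have h1 := hG e he
      have h2 := Finset.card_le_univ e
      simp only [Fintype.card_fin, mul_zero] at h2
      omega
    simp [this]
  have hC : 0 < (l * m).choose l := Nat.choose_pos (Nat.le_mul_of_pos_right l hm)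
  have hdesc : l.factorial * (l * m).choose l ≤ l ^ l * m ^ l := by
    rw [← Nat.descFactorial_eq_factorial_mul_choose, ← mul_pow]
    exact Nat.descFactorial_le_pow _ _
  have key : l.factorial * G.card ≤ X * l ^ l := by
    refine Nat.le_of_mul_le_mul_right ?_ hC
    calc l.factorial * G.card * (l * m).choose l
        = l.factorial * (l * m).choose l * G.card := by ring
      _ ≤ l ^ l * m ^ l * G.card := Nat.mul_le_mul_right _ hdesc
      _ = l ^ l * (G.card * m ^ l) := by ring
      _ ≤ l ^ l * (X * (l * m).choose l) :=
        Nat.mul_le_mul_left _ ((Nat.mul_le_mul_left _ hTm).trans hσ)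
      _ = X * l ^ l * (l * m).choose l := by ring
  have hpos : (0 : ℝ) < (l : ℝ) ^ l := by positivity
  rw [div_mul_eq_mul_div, div_le_iff₀ hpos]
  exact_mod_cast key
end
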